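/- arXiv:2509.02574 — 4 statements merged into one kernel-verified Lean document; each statement's English description precedes it below -/
import Mathlib

section
/- Let F ∈ R^{l×m} have normal rank r, where R = K[x_1,...,x_n]. If the reduced r-th order minors of F generate the unit ideal R (i.e., J_r(F) = R), then there exists a zero left prime (ZLP) polynomial matrix H ∈ R^{(l−r)×l} such that H · F = 0_{(l−r)×m}. -/
open Matrix MvPolynomial

/-- The set of `k × k` minors of a matrix: determinants of submatrices obtained by
choosing `k` rows and `k` columns. -/
def minorsSet {R : Type*} [CommRing R] {l m : ℕ} (k : ℕ)
    (F : Matrix (Fin l) (Fin m) R) : Set R :=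
  { d | ∃ (ri : Fin k → Fin l) (ci : Fin k → Fin m),
      Function.Injective ri ∧ Function.Injective ci ∧ d = (F.submatrix ri ci).det }

/-- `d` is a greatest common divisor of the `k × k` minors of `F`. -/
def IsGcdMinors {R : Type*} [CommRing R] {l m : ℕ} (k : ℕ)
    (F : Matrix (Fin l) (Fin m) R) (d : R) : Prop :=
  (∀ a ∈ minorsSet k F, d ∣ a) ∧ ∀ e : R, (∀ a ∈ minorsSet k F, e ∣ a) → e ∣ d

/-- `J_k(F) = R` : the ideal generated by the reduced `k`-th order minors
(the `k × k` minors divided by their g.c.d.) is the unit ideal. -/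
def JEqTop {R : Type*} [CommRing R] {l m : ℕ} (k : ℕ)
    (F : Matrix (Fin l) (Fin m) R) : Prop :=
  ∃ d : R, IsGcdMinors k F d ∧ Ideal.span { b : R | d * b ∈ minorsSet k F } = ⊤

/-- The normal rank of a polynomial matrix: its rank over the fraction field. -/
noncomputable def normalRank {K : Type*} [Field K] {n l m : ℕ}
    (F : Matrix (Fin l) (Fin m) (MvPolynomial (Fin n) K)) : ℕ :=
  (F.map (algebraMap (MvPolynomial (Fin n) K)
      (FractionRing (MvPolynomial (Fin n) K)))).rank

/-- Equivalence of matrices: `G = M * F * N` with `M`, `N` unimodular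
(i.e. with determinant a unit, a nonzero constant). -/
def MatEquiv {R : Type*} [CommRing R] {l m : ℕ}
    (F G : Matrix (Fin l) (Fin m) R) : Prop :=
  ∃ (M : Matrix (Fin l) (Fin l) R) (N : Matrix (Fin m) (Fin m) R),
    IsUnit M.det ∧ IsUnit N.det ∧ G = M * F * N

/-- A matrix is zero left prime (ZLP) if its maximal (row-size) order minors
generate the unit ideal. -/
def ZLP {R : Type*} [CommRing R] {l m : ℕ} (F : Matrix (Fin l) (Fin m) R) : Prop :=
  Ideal.span (minorsSet l F) = ⊤

open scoped Polynomial

theorem Module.Free.of_projective_of_smul_mem_span_singleton {B P : Type*} [CommRing B] [IsDomain B]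
    [UniqueFactorizationMonoid B] [AddCommGroup P] [Module B P] [Module.Finite B P]
    [Module.Projective B P] (p : P) (f : B) (hf : f ≠ 0) (h : ∀ x : P, ∃ c : B, f • x = c • p) :
    Module.Free B P := by
  classical
  obtain ⟨n, F, hF⟩ := Module.Finite.exists_fin' B P
  obtain ⟨s, hs⟩ := Module.projective_lifting_property F LinearMap.id hF
  have hs' : ∀ x, F (s x) = x := fun x => congrArg (fun l => l x) hs
  have hexp : ∀ c : Fin n → B, F c = ∑ i, c i • F (Pi.single i 1) := by
    intro c
    conv_lhs => rw [pi_eq_sum_univ' c]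
    simp only [map_sum, map_smul]
  let : NormalizedGCDMonoid B := Classical.arbitrary _
  have : Module.IsTorsionFree B P := inferInstance
  choose c hc using fun i : Fin n => h (F (Pi.single i 1))
  set g := Finset.univ.gcd c with hg
  have hgc : ∀ i, g ∣ c i := fun i => Finset.gcd_dvd (Finset.mem_univ i)
  choose c' hc' using hgc
  have hdvd : ∀ i, f ∣ g * s p i := by
    intro i
    have h1 : f ∣ Finset.univ.gcd (fun j => s p i * c j) := by
      refine Finset.dvd_gcd fun j _ => ?_
      have := congrArg (fun x => s x i) (hc j)
      simp only [map_smul, Pi.smul_apply, smul_eq_mul] at this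
      exact ⟨_, by rw [mul_comm, ← this]⟩
    rw [mul_comm]
    exact h1.trans (Finset.gcd_mul_left' _ _ _).dvd
  choose y hy using hdvd
  have hz : f • F y = g • p := by
    rw [← map_smul, show f • y = g • s p from funext fun i => (hy i).symm, map_smul, hs']
  have hgen : ∀ x, ∃ a : B, a • F y = x := by
    intro x
    refine ⟨∑ i, s x i * c' i, ?_⟩
    have : f • ((∑ i, s x i * c' i) • F y) = f • x := by
      rw [smul_comm, hz]
      conv_rhs => rw [← hs' x, hexp, Finset.smul_sum]
      rw [Finset.sum_smul]
      refine Finset.sum_congr rfl fun i _ => ?_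
      rw [smul_comm f, hc, hc', smul_smul, smul_smul]
      congr 1; ring
    exact smul_right_injective P hf this
  by_cases hz0 : F y = 0
  · have : Subsingleton P := ⟨fun a b => by
      obtain ⟨a', rfl⟩ := hgen a
      obtain ⟨b', rfl⟩ := hgen b
      simp [hz0]⟩
    infer_instance
  · refine Module.Free.of_equiv (LinearEquiv.ofBijective (LinearMap.toSpanSingleton B P (F y))
      ⟨fun a b hab => ?_, hgen⟩)
    exact smul_left_injective B hz0 (by simpa using hab)

theorem Polynomial.ideal_eq_top_of_monic_mem {A : Type*} [CommRing A] [IsLocalRing A]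
    (I : Ideal A[X]) (h : A[X]) (hm : h.Monic) (hI : h ∈ I) (u : A[X]) (hu : u ∈ I)
    (hu1 : u.map (IsLocalRing.residue A) = 1) : I = ⊤ := by
  by_contra hne
  obtain ⟨M, hM, hIM⟩ := Ideal.exists_le_maximal I hne
  let φ : A →+* A[X] ⧸ M := (Ideal.Quotient.mk M).comp C
  have hint : φ.IsIntegral := by
    intro x
    obtain ⟨q, rfl⟩ := Ideal.Quotient.mk_surjective x
    have hX : φ.IsIntegralElem (Ideal.Quotient.mk M X) := by
      refine ⟨h, hm, ?_⟩
      rw [← Polynomial.hom_eval₂]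
      simpa using Ideal.Quotient.eq_zero_iff_mem.2 (hIM hI)
    induction q using Polynomial.induction_on' with
    | add p q hp hq => rw [map_add]; exact hp.add φ hq
    | monomial n a =>
      rw [← C_mul_X_pow_eq_monomial, map_mul, map_pow]
      have : φ.IsIntegralElem (Ideal.Quotient.mk M (C a)) := φ.isIntegralElem_map (x := a)
      refine this.mul φ ?_
      induction n with
      | zero => simpa using φ.isIntegralElem_one
      | succ n ih => rw [pow_succ]; exact ih.mul φ hX
  have hfield := (Ideal.Quotient.maximal_ideal_iff_isField_quotient M).1 hM
  have hbot : (⊥ : Ideal (A[X] ⧸ M)).IsMaximal := by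
    let := Ideal.Quotient.field M
    exact Ideal.bot_isMaximal
  have hcm := Ideal.isMaximal_comap_of_isIntegral_of_isMaximal' φ hint ⊥
  have hmm := IsLocalRing.eq_maximalIdeal hcm
  have hker : ∀ v : A[X], v.map (IsLocalRing.residue A) = 0 → v ∈ M := by
    intro v hv
    rw [v.as_sum_range_C_mul_X_pow]
    refine Ideal.sum_mem _ fun i _ => Ideal.mul_mem_right _ _ ?_
    have : v.coeff i ∈ IsLocalRing.maximalIdeal A := by
      rw [← IsLocalRing.residue_eq_zero_iff, ← coeff_map, hv, coeff_zero]
    rw [← hmm, Ideal.mem_comap, Ideal.mem_bot] at this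
    exact Ideal.Quotient.eq_zero_iff_mem.1 this
  have h1 : (u - (u - 1) : A[X]) ∈ M := M.sub_mem (hIM hu) (hker _ (by simp [hu1]))
  exact hM.ne_top ((Ideal.eq_top_iff_one M).2 (by simpa using h1))

theorem Polynomial.exists_functional_residue_eq_one {A P : Type*} [CommRing A] [IsLocalRing A]
    [AddCommGroup P] [Module A[X] P] [Module.Finite A[X] P] [Module.Projective A[X] P]
    (ψ : P →ₗ[A[X]] A[X]) (v : P) (hv : (ψ v).Monic) :
    ∃ (φ : P →ₗ[A[X]] A[X]) (q : P), (φ q).map (IsLocalRing.residue A) = 1 := by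
  let red : A[X] →+* (IsLocalRing.ResidueField A)[X] := mapRingHom (IsLocalRing.residue A)
  have hred : Function.Surjective red := map_surjective _ IsLocalRing.residue_surjective
  let : Algebra A[X] (IsLocalRing.ResidueField A)[X] := red.toAlgebra
  set κ := (IsLocalRing.ResidueField A)[X]
  have hnt : Nontrivial (TensorProduct A[X] κ P) := by
    refine ⟨1 ⊗ₜ v, 0, fun h => ?_⟩
    have := congrArg (TensorProduct.lift ((LinearMap.lsmul A[X] κ).flip.compr₂ LinearMap.id |>.compl₂ ψ)) h
    simp only [TensorProduct.lift.tmul, map_zero] at this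
    have h2 : red (ψ v) = 0 := by
      simpa [Algebra.smul_def, RingHom.algebraMap_toAlgebra] using this
    exact (hv.map (IsLocalRing.residue A)).ne_zero h2
  let b := Module.Free.chooseBasis κ (TensorProduct A[X] κ P)
  obtain ⟨i⟩ := b.index_nonempty
  have hsurj := TensorProduct.mk_surjective A[X] P κ hred
  obtain ⟨q, hq⟩ := hsurj (b i)
  obtain ⟨φ, hφ⟩ := Module.projective_lifting_property (Algebra.linearMap A[X] κ)
    ((b.coord i).restrictScalars A[X] ∘ₗ TensorProduct.mk A[X] κ P 1) hred
  refine ⟨φ, q, ?_⟩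
  have := congrArg (fun l => l q) hφ
  simp only [LinearMap.comp_apply, hq, LinearMap.restrictScalars_apply, Module.Basis.coord_apply,
    Module.Basis.repr_self, Finsupp.single_eq_same] at this
  exact this

theorem Polynomial.exists_monic_of_residue_ne_zero {A : Type*} [CommRing A] [IsLocalRing A]
    (a : A[X]) (ha : a.map (IsLocalRing.residue A) ≠ 0) :
    ∃ (c : A) (g : A[X]), g.Monic ∧ IsUnit c ∧
      (C c * g).map (IsLocalRing.residue A) = a.map (IsLocalRing.residue A) := by
  set k := IsLocalRing.ResidueField A
  set ā := a.map (IsLocalRing.residue A) with hā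
  obtain ⟨c, hc⟩ := IsLocalRing.residue_surjective (R := A) ā.leadingCoeff
  have hmon : (ā * C ā.leadingCoeff⁻¹).Monic := Polynomial.monic_mul_leadingCoeff_inv ha
  obtain ⟨g, hg, -, hgm⟩ := lifts_and_natDegree_eq_and_monic (f := IsLocalRing.residue A)
    (map_surjective _ IsLocalRing.residue_surjective _) hmon
  refine ⟨c, g, hgm, ?_, ?_⟩
  · by_contra hcu
    have : IsLocalRing.residue A c = 0 := (IsLocalRing.residue_eq_zero_iff c).2 hcu
    exact ha (leadingCoeff_eq_zero.1 (hc ▸ this))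
  · rw [Polynomial.map_mul, hg, map_C, hc, mul_comm, mul_assoc, ← C_mul, inv_mul_cancel₀, C_1, mul_one]
    exact leadingCoeff_ne_zero.2 ha

theorem Polynomial.exists_monic_add_X_pow_mul {A : Type*} [CommRing A] [Nontrivial A] (a h : A[X])
    (hh : h.Monic) : ∃ N : ℕ, (a + X ^ N * h).Monic := by
  refine ⟨a.natDegree + 1, ?_⟩
  refine Monic.add_of_right ((monic_X_pow _).mul hh) ?_
  refine lt_of_le_of_lt degree_le_natDegree ?_
  rw [hh.degree_mul, degree_X_pow, degree_eq_natDegree hh.ne_zero]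
  exact_mod_cast Nat.lt_of_lt_of_le (Nat.lt_succ_self _) (Nat.le_add_right _ _)

theorem Polynomial.exists_unimodular_of_monic {A P : Type*} [CommRing A] [IsLocalRing A]
    [AddCommGroup P] [Module A[X] P] [Module.Finite A[X] P] [Module.Projective A[X] P] {r : ℕ}
    (f : A[X]) (hf : f.Monic) (α : (Fin (r + 2) → A[X]) →ₗ[A[X]] P)
    (β : P →ₗ[A[X]] (Fin (r + 2) → A[X])) (h2 : ∀ c, β (α c) = f • c) :
    ∃ (θ : P →ₗ[A[X]] A[X]) (p : P) (j : Fin (r + 2)), θ p = 1 ∧ (β p j).Monic := by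
  classical
  obtain ⟨φ, q, hq⟩ := exists_functional_residue_eq_one (LinearMap.proj 0 ∘ₗ β)
    (α (Pi.single 0 1)) (by simpa [h2] using hf)
  suffices ∃ (p' : P) (j : Fin (r + 2)), (φ p').map (IsLocalRing.residue A) = 0 ∧ (β p' j).Monic by
    obtain ⟨p', j, h0, hm⟩ := this
    obtain ⟨N, hN⟩ := exists_monic_add_X_pow_mul (β q j) _ hm
    have hp : φ (q + (X ^ N : A[X]) • p') = φ q + X ^ N * φ p' := by simp
    have hb : (β (q + (X ^ N : A[X]) • p') j).Monic := by simpa using hN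
    set p := q + (X ^ N : A[X]) • p'
    let ev : (P →ₗ[A[X]] A[X]) →ₗ[A[X]] A[X] := LinearMap.applyₗ p
    have htop := ideal_eq_top_of_monic_mem (LinearMap.range ev) _ hb
      ⟨LinearMap.proj j ∘ₗ β, rfl⟩ (φ p) ⟨φ, rfl⟩ (by simp [hp, hq, h0])
    obtain ⟨θ, hθ⟩ : (1 : A[X]) ∈ LinearMap.range ev := htop ▸ Submodule.mem_top
    exact ⟨θ, p, j, hθ, hb⟩
  by_cases h0 : (φ (α (Pi.single 0 1))).map (IsLocalRing.residue A) = 0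
  · exact ⟨_, 0, h0, by simpa [h2] using hf⟩
  · obtain ⟨c, g, hg, hc, hcg⟩ := exists_monic_of_residue_ne_zero _ h0
    obtain ⟨d, hd⟩ := hc.exists_right_inv
    refine ⟨g • α (Pi.single 1 1) - (C d * φ (α (Pi.single 1 1))) • α (Pi.single 0 1), 1, ?_, ?_⟩
    · rw [map_sub, map_smul, map_smul, smul_eq_mul, smul_eq_mul, Polynomial.map_sub,
        Polynomial.map_mul, Polynomial.map_mul, ← hcg, ← Polynomial.map_mul, ← Polynomial.map_mul,
        ← Polynomial.map_sub]
      rw [show g * φ (α (Pi.single 1 1)) - C d * φ (α (Pi.single 1 1)) * (C c * g)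
        = g * φ (α (Pi.single 1 1)) * (1 - C (c * d)) by rw [C_mul]; ring]
      simp [hd]
    · simpa [h2] using hg.mul hf

theorem Polynomial.free_of_projective_of_monic {A : Type*} [CommRing A] [IsDomain A]
    [UniqueFactorizationMonoid A] [IsLocalRing A] (r : ℕ) :
    ∀ {P : Type*} [AddCommGroup P] [Module A[X] P] [Module.Finite A[X] P]
      [Module.Projective A[X] P] (f : A[X]) (_ : f.Monic) (α : (Fin r → A[X]) →ₗ[A[X]] P)
      (β : P →ₗ[A[X]] (Fin r → A[X])) (_ : ∀ x, α (β x) = f • x) (_ : ∀ c, β (α c) = f • c),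
      Module.Free A[X] P := by
  classical
  induction r with
  | zero =>
    intro P _ _ _ _ f hf α β h1 _
    have : Subsingleton P := ⟨fun a b => smul_right_injective P hf.ne_zero (by
      simp only [← h1]
      rw [Subsingleton.elim (β a) (β b)])⟩
    infer_instance
  | succ r ih =>
    intro P _ _ _ _ f hf α β h1 h2
    rcases r with _ | r
    · refine Module.Free.of_projective_of_smul_mem_span_singleton (α 1) f hf.ne_zero fun x => ⟨β x 0, ?_⟩
      rw [← h1, ← map_smul]
      congr 1
      ext1 i
      fin_cases i
      simp
    · obtain ⟨θ, p, j, hθ, hm⟩ := exists_unimodular_of_monic f hf α β h2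
      let π : P →ₗ[A[X]] LinearMap.ker θ := (LinearMap.id - θ.smulRight p).codRestrict _ (fun x => by
        simp [hθ])
      have hπ : ∀ x, (π x : P) = x - θ x • p := fun x => rfl
      have hπp : π p = 0 := Subtype.ext (by simp [hπ, hθ])
      have hπk : ∀ x : LinearMap.ker θ, π x = x := fun x => Subtype.ext (by simp [hπ])
      have hπs : Function.Surjective π := fun x => ⟨x, hπk x⟩
      have : Module.Finite A[X] (LinearMap.ker θ) := Module.Finite.of_surjective π hπs
      have : Module.Projective A[X] (LinearMap.ker θ) :=
        Module.Projective.of_split (LinearMap.ker θ).subtype π (LinearMap.ext hπk)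
      let ins : (Fin (r + 1) → A[X]) →ₗ[A[X]] (Fin (r + 2) → A[X]) :=
        LinearMap.pi fun i => if h : ∃ k, j.succAbove k = i then LinearMap.proj h.choose else 0
      have hinsj : ∀ c, ins c j = 0 := fun c => by
        have : ¬ ∃ k, j.succAbove k = j := fun ⟨k, hk⟩ => Fin.succAbove_ne j k hk
        simp only [ins, LinearMap.pi_apply, dif_neg this, LinearMap.zero_apply]
      have hinsk : ∀ c k, ins c (j.succAbove k) = c k := fun c k => by
        have : ∃ k', j.succAbove k' = j.succAbove k := ⟨k, rfl⟩
        have h3 := Fin.succAbove_right_injective this.choose_spec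
        simp only [ins, LinearMap.pi_apply, dif_pos this, LinearMap.proj_apply, h3]
      let β' : LinearMap.ker θ →ₗ[A[X]] (Fin (r + 1) → A[X]) := LinearMap.pi fun k =>
        (β p j • (LinearMap.proj (j.succAbove k) ∘ₗ β) - β p (j.succAbove k) • (LinearMap.proj j ∘ₗ β))
          ∘ₗ (LinearMap.ker θ).subtype
      have hβ' : ∀ (x : LinearMap.ker θ), ins (β' x) = β p j • β x - β x j • β p := by
        intro x
        ext1 i
        rcases Fin.eq_self_or_eq_succAbove j i with rfl | ⟨k, rfl⟩
        · simp [hinsj, mul_comm]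
        · simp [hinsk, β', mul_comm]
      have hfree : Module.Free A[X] (LinearMap.ker θ) := by
        refine ih (β p j * f) (hm.mul hf) (π ∘ₗ α ∘ₗ ins) β' (fun x => ?_) (fun c => ?_)
        · simp only [LinearMap.comp_apply, hβ', map_sub, map_smul, h1, hπp, hπk]
          simp [smul_smul]
        · ext1 k
          simp only [LinearMap.comp_apply, β', LinearMap.pi_apply, LinearMap.sub_apply,
            LinearMap.smul_apply, Submodule.subtype_apply, hπ, map_sub, map_smul, h2,
            LinearMap.proj_apply, Pi.smul_apply, hinsj, hinsk, smul_eq_mul]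
          ring
      let e : P ≃ₗ[A[X]] A[X] × LinearMap.ker θ := LinearEquiv.ofLinearMap (θ.prod π)
        ((LinearMap.toSpanSingleton _ _ p).coprod (LinearMap.ker θ).subtype)
        (by
          ext
          · simp [hθ]
          · simp [hπp]
          · simp
          · simp [hπk])
        (by ext x; simp [hπ])
      exact Module.Free.of_equiv e.symm

/-- The diagonal idempotent matrix selecting the coordinates marked by `c`. -/
def Matrix.selector {ι : Type*} [DecidableEq ι] (R : Type*) [CommRing R] (c : ι → Bool) :
    Matrix ι ι R :=
  Matrix.diagonal fun i => if c i then 1 else 0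

section Selector

variable {ι : Type*} [DecidableEq ι] {R S : Type*} [CommRing R] [CommRing S]

theorem Matrix.map_selector (f : R →+* S) (c : ι → Bool) :
    (Matrix.selector R c).map f = Matrix.selector S c := by
  rw [selector, selector, Matrix.diagonal_map (map_zero f)]
  congr 1
  ext i
  simp [apply_ite f]

theorem Matrix.one_sub_selector (c : ι → Bool) :
    1 - Matrix.selector R c = Matrix.selector R fun i => !c i := by
  rw [selector, selector, ← Matrix.diagonal_one, Matrix.diagonal_sub]
  congr 1
  ext i
  cases h : c i <;> simp

variable [Fintype ι]

theorem Matrix.isConj_selector_of_free [Nontrivial R] (E : Matrix ι ι R) (hE : E * E = E)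
    [Module.Free R (LinearMap.range (Matrix.toLin' E))]
    [Module.Free R (LinearMap.range (Matrix.toLin' (1 - E)))] :
    ∃ c : ι → Bool, IsConj E (Matrix.selector R c) := by
  have hi : IsIdempotentElem (Matrix.toLin' E) := by
    rw [IsIdempotentElem, Module.End.mul_eq_comp, ← Matrix.toLin'_mul, hE]
  have hk : LinearMap.range (Matrix.toLin' (1 - E)) = LinearMap.ker (Matrix.toLin' E) := by
    rw [LinearMap.IsIdempotentElem.ker_eq_range hi, map_sub, Matrix.toLin'_one]
  have hcompl := LinearMap.IsIdempotentElem.isCompl hi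
  have : Module.Free R (LinearMap.ker (Matrix.toLin' E)) := hk ▸ inferInstance
  have : Module.Finite R (LinearMap.range (Matrix.toLin' E)) := inferInstance
  have : Module.Finite R (LinearMap.ker (Matrix.toLin' E)) := by
    rw [← hk]; exact Module.Finite.range _
  let bP := Module.Free.chooseBasis R (LinearMap.range (Matrix.toLin' E))
  let bQ := Module.Free.chooseBasis R (LinearMap.ker (Matrix.toLin' E))
  let b := (bP.prod bQ).map (Submodule.prodEquivOfIsCompl _ _ hcompl)
  let σ := b.indexEquiv (Pi.basisFun R ι)
  let b' := b.reindex σ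
  refine ⟨fun i => (σ.symm i).isLeft, IsConj.symm ⟨⟨(Pi.basisFun R ι).toMatrix b',
    b'.toMatrix (Pi.basisFun R ι), Module.Basis.toMatrix_mul_toMatrix_flip _ _,
    Module.Basis.toMatrix_mul_toMatrix_flip _ _⟩, ?_⟩⟩
  have hcol : ∀ j, E *ᵥ (b' j) = (if (σ.symm j).isLeft then (1 : R) else 0) • b' j := by
    intro j
    simp only [b', Module.Basis.reindex_apply]
    rcases σ.symm j with i | i
    · obtain ⟨y, hy⟩ := (bP i).2
      simp only [b, Module.Basis.map_apply, Module.Basis.prod_apply]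
      simp [← hy, hE]
    · have h0 : E *ᵥ (bQ i : ι → R) = 0 := (bQ i).2
      simp only [b, Module.Basis.map_apply, Module.Basis.prod_apply]
      simp [h0]
  show _ * _ = _ * _
  ext i j
  have := congrFun (hcol j) i
  rw [selector, Matrix.mul_diagonal, Matrix.mul_apply]
  simp only [Module.Basis.toMatrix_apply, Pi.basisFun_repr]
  rw [mul_comm]
  simpa [Matrix.mulVec, dotProduct] using this.symm

theorem Matrix.exists_clear_denominators [IsDomain R] [Algebra R S] (M : Submonoid R)
    (hM : M ≤ nonZeroDivisors R) [IsLocalization M S] (E F : Matrix ι ι R)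
    (h : IsConj (E.map (algebraMap R S)) (F.map (algebraMap R S))) :
    ∃ s ∈ M, ∃ U V : Matrix ι ι R, U * V = s • 1 ∧ V * U = s • 1 ∧ U * E = F * U := by
  obtain ⟨W, hW⟩ := h
  have hinj : Function.Injective (algebraMap R S) := IsLocalization.injective S hM
  have hinj' : Function.Injective fun X : Matrix ι ι R => X.map (algebraMap R S) :=
    Matrix.map_injective hinj
  obtain ⟨a, ha⟩ := IsLocalization.exist_integer_multiples_of_finite M
    (fun ij : ι × ι => (W : Matrix ι ι S) ij.1 ij.2)
  obtain ⟨b, hb⟩ := IsLocalization.exist_integer_multiples_of_finite M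
    (fun ij : ι × ι => (↑W⁻¹ : Matrix ι ι S) ij.1 ij.2)
  choose U hU using fun i j => ha (i, j)
  choose V hV using fun i j => hb (i, j)
  have hU' : (Matrix.of U).map (algebraMap R S) = (a : R) • (W : Matrix ι ι S) := by
    ext i j; exact hU i j
  have hV' : (Matrix.of V).map (algebraMap R S) = (b : R) • (↑W⁻¹ : Matrix ι ι S) := by
    ext i j; exact hV i j
  have hs : ((a * b : R) • (1 : Matrix ι ι R)).map (algebraMap R S) = (a * b : R) • 1 := by
    ext i j
    by_cases hij : i = j <;>
      simp only [Matrix.map_apply, Matrix.smul_apply, Matrix.one_apply, hij, if_true, if_false,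
        smul_eq_mul, mul_one, mul_zero, zero_smul, smul_zero,
        Algebra.algebraMap_eq_smul_one (A := S)]
  refine ⟨a * b, (a * b).2, Matrix.of U, Matrix.of V, hinj' ?_, hinj' ?_, hinj' ?_⟩
  · simp only [Matrix.map_mul, hU', hV']
    rw [hs, smul_mul_smul_comm, Units.mul_inv]
  · simp only [Matrix.map_mul, hU', hV']
    rw [hs, smul_mul_smul_comm, Units.inv_mul, mul_comm]
  · simp only [Matrix.map_mul, hU']
    rw [smul_mul_assoc, mul_smul_comm, hW.eq]

end Selector

theorem Polynomial.free_range_of_monic_conj {ι : Type*} [Fintype ι] [DecidableEq ι] {A : Type*}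
    [CommRing A] [IsDomain A] [UniqueFactorizationMonoid A] [IsLocalRing A]
    (E : Matrix ι ι A[X]) (hE : E * E = E) (f : A[X]) (hf : f.Monic) (c : ι → Bool)
    (U V : Matrix ι ι A[X]) (hUV : U * V = f • 1) (hVU : V * U = f • 1)
    (hU : U * E = Matrix.selector _ c * U) :
    Module.Free A[X] (LinearMap.range (Matrix.toLin' E)) := by
  let g := Matrix.toLin' E
  have hgr : ∀ x : LinearMap.range g, E *ᵥ (x : ι → A[X]) = x := by
    rintro ⟨_, y, rfl⟩
    simp [g, hE]
  let π : (ι → A[X]) →ₗ[A[X]] LinearMap.range g := g.rangeRestrict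
  have hπ : ∀ x : LinearMap.range g, π x = x := fun x => Subtype.ext (hgr x)
  have : Module.Projective A[X] (LinearMap.range g) :=
    Module.Projective.of_split (LinearMap.range g).subtype π (LinearMap.ext hπ)
  have hEV : E * V = V * Matrix.selector _ c := by
    have : f • (E * V) = f • (V * Matrix.selector _ c) := by
      calc f • (E * V) = V * (U * E) * V := by
            rw [← Matrix.mul_assoc, hVU, Matrix.smul_mul, Matrix.one_mul, Matrix.smul_mul]
        _ = f • (V * Matrix.selector _ c) := by
            rw [hU, Matrix.mul_assoc, Matrix.mul_assoc, hUV, Matrix.mul_smul, Matrix.mul_one,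
              Matrix.mul_smul]
    exact smul_right_injective _ hf.ne_zero this
  let e := Fintype.equivFin {i // c i = true}
  let ins : (Fin (Fintype.card {i // c i = true}) → A[X]) →ₗ[A[X]] (ι → A[X]) :=
    LinearMap.pi fun i => if h : c i = true then LinearMap.proj (e ⟨i, h⟩) else 0
  let res : (ι → A[X]) →ₗ[A[X]] (Fin (Fintype.card {i // c i = true}) → A[X]) :=
    LinearMap.pi fun k => LinearMap.proj (e.symm k : ι)
  have hir : ∀ x, ins (res x) = Matrix.selector _ c *ᵥ x := by
    intro x
    ext1 i
    by_cases h : c i = true <;> simp [ins, res, Matrix.selector, Matrix.mulVec_diagonal, h]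
  have hri : ∀ y, res (ins y) = y := by
    intro y
    ext1 k
    have := (e.symm k).2
    simp [ins, res, this]
  have hsi : ∀ y, Matrix.selector _ c *ᵥ ins y = ins y := by
    intro y; rw [← hir, hri]
  refine free_of_projective_of_monic _ f hf (π ∘ₗ Matrix.toLin' V ∘ₗ ins)
    (res ∘ₗ Matrix.toLin' U ∘ₗ (LinearMap.range g).subtype) (fun x => ?_) (fun y => ?_)
  · have h1 : ins (res (U *ᵥ x)) = U *ᵥ x := by
      rw [hir, Matrix.mulVec_mulVec, ← hU, ← Matrix.mulVec_mulVec, hgr]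
    simp only [LinearMap.comp_apply, Matrix.toLin'_apply, Submodule.subtype_apply, h1,
      Matrix.mulVec_mulVec, hVU, Matrix.smul_mulVec, Matrix.one_mulVec, map_smul, hπ]
  · have h1 : (π (V *ᵥ ins y) : ι → A[X]) = V *ᵥ ins y := by
      change E *ᵥ (V *ᵥ ins y) = _
      rw [Matrix.mulVec_mulVec, hEV, ← Matrix.mulVec_mulVec, hsi]
    simp only [LinearMap.comp_apply, Matrix.toLin'_apply, Submodule.subtype_apply, h1,
      Matrix.mulVec_mulVec, hUV, Matrix.smul_mulVec, Matrix.one_mulVec, map_smul, hri]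

theorem Polynomial.isConj_selector_of_monic_conj {ι : Type*} [Fintype ι] [DecidableEq ι]
    {A : Type*} [CommRing A] [IsDomain A] [UniqueFactorizationMonoid A] [IsLocalRing A]
    (E : Matrix ι ι A[X]) (hE : E * E = E) (f : A[X]) (hf : f.Monic) (c : ι → Bool)
    (U V : Matrix ι ι A[X]) (hUV : U * V = f • 1) (hVU : V * U = f • 1)
    (hU : U * E = Matrix.selector _ c * U) :
    ∃ c' : ι → Bool, IsConj E (Matrix.selector _ c') := by
  have h1 := free_range_of_monic_conj E hE f hf c U V hUV hVU hU
  have h2 := free_range_of_monic_conj (1 - E) (IsIdempotentElem.one_sub hE) f hf (fun i => !c i)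
    U V hUV hVU (by rw [← Matrix.one_sub_selector, mul_sub, sub_mul, hU, mul_one, one_mul])
  exact Matrix.isConj_selector_of_free E hE

theorem Polynomial.isConj_of_locally_conj {ι : Type*} [Fintype ι] [DecidableEq ι] {A : Type*}
    [CommRing A] [IsDomain A] (E : Matrix ι ι A[X])
    (h : ∀ m : Ideal A, m.IsMaximal → ∃ s ∉ m, ∃ (U V : Matrix ι ι A[X]) (D : Matrix ι ι A),
      U * V = C s • 1 ∧ V * U = C s • 1 ∧ U * E = D.map C * U) :
    IsConj E (E.map (C.comp (evalRingHom 0))) := by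
  let at' (u : A[X]) (M : Matrix ι ι A[X]) : Matrix ι ι A[X] := M.map (compRingHom u)
  let J : Ideal A :=
    { carrier := {s | ∀ u v : A[X], C s ∣ u - v → IsConj (at' u E) (at' v E)}
      zero_mem' := by
        intro u v huv
        rw [C_0, zero_dvd_iff, sub_eq_zero] at huv
        rw [huv]
      add_mem' := by
        intro s t hs ht u v ⟨w, hw⟩
        refine (hs u (u - C s * w) ⟨w, by ring⟩).trans (ht _ v ⟨w, ?_⟩)
        rw [C_add] at hw
        linear_combination hw
      smul_mem' := by
        intro a s hs u v huv
        refine hs u v (dvd_trans ?_ huv)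
        rw [smul_eq_mul, C_mul]
        exact dvd_mul_left _ _ }
  have hJ : J = ⊤ := by
    by_contra hne
    obtain ⟨m, hm, hJm⟩ := Ideal.exists_le_maximal J hne
    obtain ⟨s, hsm, U, V, D, hUV, hVU, hU⟩ := h m hm
    refine hsm (hJm ?_)
    have hs0 : (C s : A[X]) ≠ 0 := by
      rw [Ne, C_eq_zero]
      rintro rfl
      exact hsm m.zero_mem
    have hcan : Function.Injective fun M : Matrix ι ι A[X] => (C s : A[X]) • M :=
      smul_right_injective _ hs0
    have hmul : ∀ u M N, at' u (M * N) = at' u M * at' u N := fun u M N => Matrix.map_mul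
    have hs1 : ∀ u, at' u ((C s : A[X]) • 1) = (C s : A[X]) • 1 := by
      intro u
      ext i j
      by_cases hij : i = j <;> simp [at', hij]
    have hD : ∀ u, at' u (D.map C) = D.map C := by
      intro u; ext i j; simp [at']
    have hUVu : ∀ u, at' u U * at' u V = (C s : A[X]) • 1 := fun u => by rw [← hmul, hUV, hs1]
    have hVUu : ∀ u, at' u V * at' u U = (C s : A[X]) • 1 := fun u => by rw [← hmul, hVU, hs1]
    have hUu : ∀ u, at' u U * at' u E = D.map C * at' u U := fun u => by
      rw [← hmul, hU, hmul, hD]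
    have hVu : ∀ u, at' u E * at' u V = at' u V * D.map C := fun u => by
      apply hcan
      calc (C s : A[X]) • (at' u E * at' u V) = at' u V * (at' u U * at' u E) * at' u V := by
            rw [← Matrix.mul_assoc, hVUu, Matrix.smul_mul, Matrix.one_mul, Matrix.smul_mul]
        _ = _ := by
            rw [hUu, Matrix.mul_assoc, Matrix.mul_assoc, hUVu, Matrix.mul_smul, Matrix.mul_one,
              Matrix.mul_smul]
    have key : ∀ u v : A[X], C s ∣ u - v → ∃ W, C s • W = at' v V * at' u U := by
      intro u v huv
      have hd : ∀ i j, ∃ w, at' u U i j - at' v U i j = C s * w := fun i j =>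
        huv.trans (by
          simp only [at', Matrix.map_apply, coe_compRingHom_apply, comp, ← eval_map]
          exact sub_dvd_eval_sub u v ((U i j).map C))
      choose w hw using hd
      refine ⟨1 + at' v V * Matrix.of w, ?_⟩
      have : (C s : A[X]) • Matrix.of w = at' u U - at' v U := by
        ext1 i j; exact (hw i j).symm
      rw [smul_add, ← Matrix.mul_smul, this, mul_sub, hVUu]
      abel
    intro u v huv
    obtain ⟨W, hW⟩ := key u v huv
    obtain ⟨W', hW'⟩ := key v u (by rw [← neg_sub]; exact huv.neg_right)
    have one : ∀ u v W W', (C s : A[X]) • W = at' v V * at' u U →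
        (C s : A[X]) • W' = at' u V * at' v U → W * W' = 1 := by
      intro u v W W' hW hW'
      apply hcan
      apply hcan
      calc (C s : A[X]) • (C s : A[X]) • (W * W') = (C s • W) * (C s • W') := by
            rw [Matrix.smul_mul, Matrix.mul_smul]
        _ = at' v V * (at' u U * at' u V) * at' v U := by
            rw [hW, hW']; simp only [Matrix.mul_assoc]
        _ = _ := by
            rw [hUVu, Matrix.mul_smul, Matrix.mul_one, Matrix.smul_mul, hVUu]
    refine ⟨⟨W, W', one u v W W' hW hW', one v u W' W hW' hW⟩, ?_⟩
    change W * _ = _ * W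
    apply hcan
    change C s • (W * at' u E) = C s • (at' v E * W)
    rw [← Matrix.smul_mul, hW, ← Matrix.mul_smul, hW, Matrix.mul_assoc, hUu, ← Matrix.mul_assoc,
      ← hVu, Matrix.mul_assoc]
  have h1 : (1 : A) ∈ J := hJ ▸ Submodule.mem_top
  have h2 : IsConj (at' X E) (at' 0 E) := h1 X 0 (by simp)
  have e1 : at' X E = E := by ext i j; simp [at']
  have e2 : at' 0 E = E.map (C.comp (evalRingHom 0)) := by
    ext1 i j
    simp [at', Polynomial.comp_zero]
  rwa [e1, e2] at h2

theorem Matrix.isConj_map {ι : Type*} [Fintype ι] [DecidableEq ι] {R S : Type*} [CommRing R]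
    [CommRing S] (f : R →+* S) {E F : Matrix ι ι R} (h : IsConj E F) :
    IsConj (E.map f) (F.map f) :=
  f.mapMatrix.toMonoidHom.map_isConj h

theorem Matrix.map_smul_one {ι : Type*} [DecidableEq ι] {R S : Type*} [CommRing R]
    [CommRing S] (f : R →+* S) (a : R) :
    (a • (1 : Matrix ι ι R)).map f = f a • (1 : Matrix ι ι S) := by
  ext i j
  by_cases hij : i = j <;> simp [hij]

theorem Polynomial.isConj_eval_zero_of_monic_conj {ι : Type*} [Fintype ι] [DecidableEq ι]
    {A : Type*} [CommRing A] [IsDomain A] [UniqueFactorizationMonoid A]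
    (E : Matrix ι ι A[X]) (hE : E * E = E) (f : A[X]) (hf : f.Monic) (c : ι → Bool)
    (U V : Matrix ι ι A[X]) (hUV : U * V = f • 1) (hVU : V * U = f • 1)
    (hU : U * E = Matrix.selector _ c * U) :
    IsConj E (E.map (C.comp (evalRingHom 0))) := by
  refine isConj_of_locally_conj E fun m hm => ?_
  let Am := Localization.AtPrime m
  let φ : A[X] →+* Am[X] := mapRingHom (algebraMap A Am)
  have : IsDomain Am := IsLocalization.isDomain_localization m.primeCompl_le_nonZeroDivisors
  obtain ⟨c', hc'⟩ := isConj_selector_of_monic_conj (E.map φ) (by rw [← Matrix.map_mul, hE])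
    (φ f) (hf.map _) c (U.map φ) (V.map φ) (by rw [← Matrix.map_mul, hUV, Matrix.map_smul_one])
    (by rw [← Matrix.map_mul, hVU, Matrix.map_smul_one])
    (by rw [← Matrix.map_mul, hU, Matrix.map_mul, Matrix.map_selector])
  let : Algebra A[X] Am[X] := Polynomial.algebra A Am
  have : IsLocalization (m.primeCompl.map C) Am[X] := Polynomial.isLocalization m.primeCompl Am
  obtain ⟨s, ⟨a, ha, rfl⟩, U', V', h1, h2, h3⟩ := Matrix.exists_clear_denominators (S := Am[X])
    (m.primeCompl.map (C : A →+* A[X])) (by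
      rintro _ ⟨a, ha, rfl⟩
      refine mem_nonZeroDivisors_of_ne_zero ?_
      rw [Ne, C_eq_zero]
      rintro rfl
      exact ha m.zero_mem) E (Matrix.selector _ c')
    (by rw [Matrix.map_selector]; exact hc')
  exact ⟨a, ha, U', V', Matrix.selector A c', h1, h2, by rwa [Matrix.map_selector]⟩

/-- Every idempotent matrix over `R` is similar to a diagonal matrix with entries `0` and `1`. -/
def Matrix.IdempotentsDiagonalizable (R : Type*) [CommRing R] : Prop :=
  ∀ (l : ℕ) (E : Matrix (Fin l) (Fin l) R), E * E = E →
    ∃ c : Fin l → Bool, IsConj E (Matrix.selector R c)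

theorem Matrix.IdempotentsDiagonalizable.of_field (K : Type*) [Field K] :
    IdempotentsDiagonalizable K :=
  fun _ E hE => isConj_selector_of_free E hE

theorem Matrix.IdempotentsDiagonalizable.of_ringEquiv {R S : Type*} [CommRing R] [CommRing S]
    (e : R ≃+* S) (h : IdempotentsDiagonalizable R) : IdempotentsDiagonalizable S := by
  intro l E hE
  obtain ⟨c, hc⟩ := h l (E.map (e.symm : S →+* R)) (by rw [← Matrix.map_mul, hE])
  refine ⟨c, ?_⟩
  have := isConj_map (e : R →+* S) hc
  rw [map_selector] at this
  convert this
  ext i j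
  simp

/-- Interchange of a polynomial variable with a finite family of polynomial variables. -/
noncomputable def MvPolynomial.polynomialSwap (K : Type*) [CommRing K] (σ : Type*) :
    MvPolynomial σ K[X] ≃ₐ[K] (MvPolynomial σ K)[X] :=
  (MvPolynomial.optionEquivRight K σ).symm.trans (MvPolynomial.optionEquivLeft K σ)

theorem MvPolynomial.polynomialSwap_C (K : Type*) [CommRing K] (σ : Type*) (g : K[X]) :
    polynomialSwap K σ (MvPolynomial.C g) = g.map MvPolynomial.C := by
  have : ((polynomialSwap K σ : MvPolynomial σ K[X] ≃ₐ[K] (MvPolynomial σ K)[X]) :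
      MvPolynomial σ K[X] →+* (MvPolynomial σ K)[X]).comp MvPolynomial.C
      = Polynomial.mapRingHom MvPolynomial.C := by
    refine Polynomial.ringHom_ext (fun a => ?_) ?_
    · simp only [RingHom.comp_apply, RingHom.coe_coe, polynomialSwap, AlgEquiv.trans_apply,
        Polynomial.coe_mapRingHom, Polynomial.map_C]
      rw [← MvPolynomial.optionEquivRight_C, AlgEquiv.symm_apply_apply,
        MvPolynomial.optionEquivLeft_C]
    · simp only [RingHom.comp_apply, RingHom.coe_coe, polynomialSwap, AlgEquiv.trans_apply,
        Polynomial.coe_mapRingHom, Polynomial.map_X]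
      rw [← MvPolynomial.optionEquivRight_X_none, AlgEquiv.symm_apply_apply,
        MvPolynomial.optionEquivLeft_X_none]
  exact congrArg (fun φ => φ g) this

theorem Matrix.IdempotentsDiagonalizable.polynomial {K : Type*} [Field K] {σ : Type*} [Finite σ]
    (hA : IdempotentsDiagonalizable (MvPolynomial σ K))
    (hL : IdempotentsDiagonalizable (MvPolynomial σ (FractionRing K[X]))) :
    IdempotentsDiagonalizable (MvPolynomial σ K)[X] := by
  intro l E hE
  let e := MvPolynomial.polynomialSwap K σ
  let ε : MvPolynomial σ K[X] →+* (MvPolynomial σ K)[X] := e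
  let E' := E.map (e.symm : _ →+* MvPolynomial σ K[X])
  have hE'E : E'.map ε = E := by ext1 i j; simp [E', ε]
  let : Algebra (MvPolynomial σ K[X]) (MvPolynomial σ (FractionRing K[X])) :=
    MvPolynomial.algebraMvPolynomial
  obtain ⟨c, hc⟩ := hL l (E'.map (algebraMap _ _)) (by
    rw [← Matrix.map_mul, ← Matrix.map_mul, hE])
  let M := (nonZeroDivisors K[X]).map (MvPolynomial.C (σ := σ))
  have : IsLocalization M (MvPolynomial σ (FractionRing K[X])) :=
    MvPolynomial.isLocalization (nonZeroDivisors K[X]) (FractionRing K[X])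
  obtain ⟨s, ⟨g, hg, rfl⟩, U, V, h1, h2, h3⟩ :=
    exists_clear_denominators (S := MvPolynomial σ (FractionRing K[X])) M (by
      rintro _ ⟨a, ha, rfl⟩
      refine mem_nonZeroDivisors_of_ne_zero ?_
      rw [Ne, MvPolynomial.C_eq_zero]
      exact nonZeroDivisors.ne_zero ha) E' (selector _ c) (by rw [map_selector]; exact hc)
  have hg0 : g ≠ 0 := nonZeroDivisors.ne_zero hg
  let k : (MvPolynomial σ K)[X] := Polynomial.C (MvPolynomial.C g.leadingCoeff⁻¹)
  let f : (MvPolynomial σ K)[X] := (g * Polynomial.C g.leadingCoeff⁻¹).map MvPolynomial.C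
  have hf : f.Monic := (Polynomial.monic_mul_leadingCoeff_inv hg0).map _
  have hkf : k * ε (MvPolynomial.C g) = f := by
    have : ε (MvPolynomial.C g) = g.map MvPolynomial.C := MvPolynomial.polynomialSwap_C K σ g
    rw [this]
    show _ = Polynomial.map _ (g * Polynomial.C _)
    rw [Polynomial.map_mul, Polynomial.map_C, mul_comm]
  have hconj := Polynomial.isConj_eval_zero_of_monic_conj E hE f hf c (k • U.map ε) (V.map ε)
    (by rw [Matrix.smul_mul, ← Matrix.map_mul, h1, map_smul_one, smul_smul, ← hkf])
    (by rw [Matrix.mul_smul, ← Matrix.map_mul, h2, map_smul_one, smul_smul, ← hkf])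
    (by
      conv_lhs => rw [← hE'E]
      rw [Matrix.smul_mul, ← Matrix.map_mul, h3, Matrix.map_mul, map_selector, Matrix.mul_smul])
  obtain ⟨c', hc'⟩ := hA l (E.map (Polynomial.evalRingHom 0)) (by rw [← Matrix.map_mul, hE])
  refine ⟨c', hconj.trans ?_⟩
  have := isConj_map (Polynomial.C : MvPolynomial σ K →+* _) hc'
  rw [map_selector] at this
  exact this

/-- The Quillen–Suslin theorem, in terms of idempotent matrices. -/
theorem Matrix.IdempotentsDiagonalizable.mvPolynomial (n : ℕ) :
    ∀ (K : Type*) [Field K], IdempotentsDiagonalizable (MvPolynomial (Fin n) K) := by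
  induction n with
  | zero =>
    intro K _
    exact (of_field K).of_ringEquiv (MvPolynomial.isEmptyRingEquiv K (Fin 0)).symm
  | succ n ih =>
    intro K _
    exact ((ih K).polynomial (ih (FractionRing K[X]))).of_ringEquiv
      (MvPolynomial.finSuccEquiv K n).symm.toRingEquiv

theorem span_minorsSet_eq_top_of_mul_eq_one {R : Type*} [CommRing R] {k l : ℕ}
    (H : Matrix (Fin k) (Fin l) R) (V : Matrix (Fin l) (Fin k) R) (h : H * V = 1) :
    Ideal.span (minorsSet k H) = ⊤ := by
  rw [Ideal.eq_top_iff_one]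
  have hdet : ((H * V)ᵀ).det = 1 := by rw [h, Matrix.transpose_one, Matrix.det_one]
  have hrow : (H * V)ᵀ = Matrix.of fun j => ∑ i, V i j • Hᵀ i := by
    ext j i
    simp [Matrix.mul_apply, Finset.sum_apply, mul_comm]
  have hsum : Matrix.det (Matrix.of fun j => ∑ i, V i j • Hᵀ i)
      = ∑ q : Fin k → Fin l, Matrix.detRowAlternating fun j => V (q j) j • Hᵀ (q j) :=
    (Matrix.detRowAlternating (R := R) (n := Fin k)).toMultilinearMap.map_sum
      fun j i => V i j • Hᵀ i
  rw [← hdet, hrow, hsum]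
  refine Ideal.sum_mem _ fun q _ => ?_
  rw [AlternatingMap.map_smul_univ]
  refine Ideal.mul_mem_left _ _ ?_
  by_cases hq : Function.Injective q
  · refine Ideal.subset_span ⟨id, q, Function.injective_id, hq, ?_⟩
    rw [← Matrix.det_transpose]
    rfl
  · obtain ⟨a, b, hab, hne⟩ : ∃ a b, q a = q b ∧ a ≠ b := by
      simpa [Function.Injective] using hq
    rw [AlternatingMap.map_eq_zero_of_eq _ _ (by rw [hab]) hne]
    exact Ideal.zero_mem _

theorem Matrix.exists_linearIndependent_rows {L : Type*} [Field L] {l m r : ℕ}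
    (F : Matrix (Fin l) (Fin m) L) (hF : F.rank = r) :
    ∃ ri : Fin r → Fin l, LinearIndependent L (F.submatrix ri id).row := by
  rw [F.rank_eq_finrank_span_row] at hF
  subst hF
  obtain ⟨f, hf, -, hli⟩ := Submodule.exists_fun_fin_finrank_span_eq L (Set.range F.row)
  choose ri hri using hf
  refine ⟨ri, ?_⟩
  rwa [show (F.submatrix ri id).row = f from funext hri]

theorem Matrix.exists_submatrix_det_ne_zero {L : Type*} [Field L] {l m r : ℕ}
    (F : Matrix (Fin l) (Fin m) L) (hF : F.rank = r) :
    ∃ (ri : Fin r → Fin l) (ci : Fin r → Fin m), (F.submatrix ri ci).det ≠ 0 := by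
  obtain ⟨ri, hri⟩ := F.exists_linearIndependent_rows hF
  obtain ⟨ci, hci⟩ := (F.submatrix ri id)ᵀ.exists_linearIndependent_rows
    (by rw [Matrix.rank_transpose, hri.rank_matrix, Fintype.card_fin])
  refine ⟨ri, ci, ?_⟩
  have := (Matrix.linearIndependent_rows_iff_isUnit.mp hci).map Matrix.detMonoidHom
  rw [← Matrix.det_transpose]
  exact this.ne_zero

theorem Matrix.submatrix_mul_adjugate_mul_submatrix {L : Type*} [Field L] {l m r : ℕ}
    (F : Matrix (Fin l) (Fin m) L) (hF : F.rank = r) (ri : Fin r → Fin l) (ci : Fin r → Fin m)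
    (h : (F.submatrix ri ci).det ≠ 0) :
    F.submatrix id ci * (F.submatrix ri ci).adjugate * F.submatrix ri id
      = (F.submatrix ri ci).det • F := by
  have hspan : Submodule.span L (Set.range (F.submatrix ri id).row)
      = Submodule.span L (Set.range F.row) := by
    refine Submodule.eq_of_le_of_finrank_le (Submodule.span_mono ?_) ?_
    · rintro _ ⟨i, rfl⟩
      exact ⟨ri i, rfl⟩
    · rw [← Matrix.rank_eq_finrank_span_row, ← Matrix.rank_eq_finrank_span_row, hF]
      calc r = (F.submatrix ri ci).rank := by
            rw [Matrix.rank_of_det_ne_zero h, Fintype.card_fin]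
        _ ≤ (F.submatrix ri id).rank := (F.submatrix ri id).rank_submatrix_le id ci
  have hmem (i : Fin l) : ∃ c : Fin r → L, ∑ j, c j • (F.submatrix ri id).row j = F.row i := by
    rw [← Submodule.mem_span_range_iff_exists_fun, hspan]
    exact Submodule.subset_span ⟨i, rfl⟩
  choose C hC using hmem
  have hCF : Matrix.of C * F.submatrix ri id = F := by
    ext i j
    rw [Matrix.mul_apply]
    simpa [Finset.sum_apply] using congrFun (hC i) j
  have hCJ : F.submatrix id ci = Matrix.of C * F.submatrix ri ci := by
    conv_lhs => rw [← hCF]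
    rfl
  rw [hCJ, Matrix.mul_assoc (Matrix.of C), Matrix.mul_adjugate, Matrix.mul_smul, Matrix.mul_one,
    Matrix.smul_mul, hCF]

theorem dvd_det_submatrix_of_dvd_minors {R : Type*} [CommRing R] {l m k : ℕ}
    (F : Matrix (Fin l) (Fin m) R) (d : R) (hd : ∀ a ∈ minorsSet k F, d ∣ a)
    (ri : Fin k → Fin l) (ci : Fin k → Fin m) : d ∣ (F.submatrix ri ci).det := by
  by_cases hr : Function.Injective ri
  · by_cases hc : Function.Injective ci
    · exact hd _ ⟨ri, ci, hr, hc, rfl⟩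
    · obtain ⟨a, b, hab, hne⟩ : ∃ a b, ci a = ci b ∧ a ≠ b := by
        simpa [Function.Injective] using hc
      rw [Matrix.det_zero_of_column_eq hne fun i => by simp [hab]]
      exact dvd_zero d
  · obtain ⟨a, b, hab, hne⟩ : ∃ a b, ri a = ri b ∧ a ≠ b := by
      simpa [Function.Injective] using hr
    rw [Matrix.det_zero_of_row_eq hne (by ext; simp [hab])]
    exact dvd_zero d

theorem Matrix.submatrix_mul_adjugate_apply {R : Type*} [CommRing R] {l m k : ℕ}
    (F : Matrix (Fin l) (Fin m) R) (ri : Fin k → Fin l) (ci : Fin k → Fin m) (i : Fin l)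
    (j : Fin k) :
    (F.submatrix id ci * (F.submatrix ri ci).adjugate) i j
      = (F.submatrix (Function.update ri j i) ci).det := by
  have h := Matrix.cramer_transpose_apply (F.submatrix ri ci) (F.submatrix id ci i) j
  rw [Matrix.cramer_eq_adjugate_mulVec, ← Matrix.adjugate_transpose, Matrix.mulVec_transpose] at h
  rw [Matrix.mul_apply_eq_vecMul, h]
  congr 1
  ext a b
  by_cases ha : a = j
  · subst ha; simp
  · simp [ha]

/-- If the reduced minors of maximal order generate the unit ideal, then the column space of the
matrix, divided by the gcd `d`, is the image of an idempotent. -/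
theorem exists_idempotent_of_reduced_minors {R L : Type*} [CommRing R] [IsDomain R] [Field L]
    [Algebra R L] [FaithfulSMul R L] {l m r : ℕ} (F : Matrix (Fin l) (Fin m) R)
    (hF : (F.map (algebraMap R L)).rank = r) (d : R) (hd : ∀ a ∈ minorsSet r F, d ∣ a)
    (hspan : Ideal.span {b : R | d * b ∈ minorsSet r F} = ⊤) :
    d ≠ 0 ∧ ∃ (E : Matrix (Fin l) (Fin l) R) (X : Matrix (Fin m) (Fin l) R),
      E * E = E ∧ E * F = F ∧ d • E = F * X := by
  have hinj : Function.Injective (algebraMap R L) := FaithfulSMul.algebraMap_injective R L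
  have hsub (ri : Fin r → Fin l) (ci : Fin r → Fin m) :
      ((F.map (algebraMap R L)).submatrix ri ci).det
        = algebraMap R L (F.submatrix ri ci).det := by
    rw [RingHom.map_det]
    rfl
  have hd0 : d ≠ 0 := by
    rintro rfl
    obtain ⟨ri, ci, h⟩ := (F.map (algebraMap R L)).exists_submatrix_det_ne_zero hF
    rw [hsub, zero_dvd_iff.mp (dvd_det_submatrix_of_dvd_minors F 0 hd ri ci), map_zero] at h
    exact h rfl
  refine ⟨hd0, ?_⟩
  have hsmul {p q : ℕ} {A B : Matrix (Fin p) (Fin q) R} (h : d • A = d • B) : A = B := by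
    ext i j
    exact mul_left_cancel₀ hd0 (congrFun (congrFun h i) j)
  have key : ∀ a ∈ Ideal.span {b : R | d * b ∈ minorsSet r F},
      ∃ (P : Matrix (Fin l) (Fin l) R) (X : Matrix (Fin m) (Fin l) R),
        P * F = a • F ∧ d • P = F * X := by
    intro a ha
    induction ha using Submodule.span_induction with
    | zero => exact ⟨0, 0, by simp, by simp⟩
    | add a b _ _ iha ihb =>
      obtain ⟨P, X, h1, h2⟩ := iha
      obtain ⟨Q, Y, h3, h4⟩ := ihb
      exact ⟨P + Q, X + Y, by rw [Matrix.add_mul, h1, h3, add_smul],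
        by rw [Matrix.mul_add, smul_add, h2, h4]⟩
    | smul c a _ iha =>
      obtain ⟨P, X, h1, h2⟩ := iha
      exact ⟨c • P, c • X, by rw [Matrix.smul_mul, h1, smul_assoc],
        by rw [Matrix.mul_smul, smul_comm, h2]⟩
    | mem b hb =>
      obtain ⟨ri, ci, -, -, hdet⟩ := hb
      by_cases hb0 : b = 0
      · exact ⟨0, 0, by simp [hb0], by simp⟩
      have hdet0 : (F.submatrix ri ci).det ≠ 0 := hdet ▸ mul_ne_zero hd0 hb0
      have hFL : F.submatrix id ci * (F.submatrix ri ci).adjugate * F.submatrix ri id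
          = (F.submatrix ri ci).det • F := by
        refine Matrix.map_injective hinj ?_
        have := (F.map (algebraMap R L)).submatrix_mul_adjugate_mul_submatrix hF ri ci
          (by rw [hsub]; exact (map_ne_zero_iff _ hinj).mpr hdet0)
        rw [hsub] at this
        show (_ * _ * _ : Matrix _ _ R).map _ = Matrix.map (_ • _) _
        have hs : ((F.submatrix ri ci).det • F).map (algebraMap R L)
            = algebraMap R L (F.submatrix ri ci).det • F.map (algebraMap R L) := by
          ext i j
          exact map_mul (algebraMap R L) _ _
        rw [Matrix.map_mul, Matrix.map_mul, hs, ← this,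
          ← RingHom.mapMatrix_apply (algebraMap R L) (F.submatrix ri ci).adjugate,
          RingHom.map_adjugate]
        rfl
      choose G hG using fun i j =>
        (F.submatrix_mul_adjugate_apply ri ci i j).symm ▸
          dvd_det_submatrix_of_dvd_minors F d hd (Function.update ri j i) ci
      have hG' : F.submatrix id ci * (F.submatrix ri ci).adjugate = d • Matrix.of G := by
        ext i j
        exact hG i j
      have hsel : (1 : Matrix (Fin l) (Fin l) R).submatrix ri id * F = F.submatrix ri id := by
        show ((1 : Matrix (Fin l) (Fin l) R) * F).submatrix ri id = _
        rw [Matrix.one_mul]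
      have hsel' : F * (1 : Matrix (Fin m) (Fin m) R).submatrix id ci = F.submatrix id ci := by
        show (F * (1 : Matrix (Fin m) (Fin m) R)).submatrix id ci = _
        rw [Matrix.mul_one]
      refine ⟨Matrix.of G * (1 : Matrix (Fin l) (Fin l) R).submatrix ri id,
        (1 : Matrix (Fin m) (Fin m) R).submatrix id ci * (F.submatrix ri ci).adjugate
          * (1 : Matrix (Fin l) (Fin l) R).submatrix ri id, ?_, ?_⟩
      · rw [Matrix.mul_assoc, hsel]
        apply hsmul
        rw [← Matrix.smul_mul, ← hG', hFL, ← hdet, smul_smul]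
      · rw [← Matrix.smul_mul, ← hG', ← Matrix.mul_assoc, ← Matrix.mul_assoc, hsel']
  obtain ⟨E, X, h1, h2⟩ := key 1 (hspan ▸ Submodule.mem_top)
  rw [one_smul] at h1
  refine ⟨E, X, hsmul ?_, h1, h2⟩
  rw [← Matrix.mul_smul, h2, ← Matrix.mul_assoc, h1]

theorem Matrix.exists_zlp_annihilator_of_isConj_selector {R L : Type*} [CommRing R] [Field L]
    [Algebra R L] {l r : ℕ} (E : Matrix (Fin l) (Fin l) R)
    (c : Fin l → Bool) (hc : IsConj E (Matrix.selector R c))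
    (hE : (E.map (algebraMap R L)).rank = r) :
    ∃ H : Matrix (Fin (l - r)) (Fin l) R, ZLP H ∧ H * E = 0 := by
  classical
  obtain ⟨U, hU⟩ := hc
  have hrank : Fintype.card {i // c i = true} = r := by
    obtain ⟨W, hW⟩ := (algebraMap R L).mapMatrix.toMonoidHom.map_isConj ⟨U, hU⟩
    have hW' : (W : Matrix (Fin l) (Fin l) L) * E.map (algebraMap R L)
        = Matrix.selector L c * W := by
      rw [← Matrix.map_selector (algebraMap R L)]
      exact hW
    have h1 : IsUnit (W : Matrix (Fin l) (Fin l) L).det :=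
      (Matrix.isUnit_iff_isUnit_det _).mp W.isUnit
    rw [← hE, ← Matrix.rank_mul_eq_right_of_isUnit_det _ (E.map (algebraMap R L)) h1, hW',
      Matrix.rank_mul_eq_left_of_isUnit_det _ _ h1, Matrix.selector, Matrix.rank_diagonal]
    exact Fintype.card_congr (Equiv.subtypeEquivRight fun i => by simp)
  have hcard : Fintype.card {i // ¬ c i = true} = l - r := by
    rw [Fintype.card_subtype_compl, hrank, Fintype.card_fin]
  let s : Fin (l - r) ≃ {i // ¬ c i = true} := (Fintype.equivFinOfCardEq hcard).symm
  let H := (U : Matrix (Fin l) (Fin l) R).submatrix (fun i => (s i : Fin l)) id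
  refine ⟨H, ?_, ?_⟩
  · refine span_minorsSet_eq_top_of_mul_eq_one H
      ((↑U⁻¹ : Matrix (Fin l) (Fin l) R).submatrix id fun i => (s i : Fin l)) ?_
    show ((U : Matrix (Fin l) (Fin l) R) * (↑U⁻¹ : Matrix (Fin l) (Fin l) R)).submatrix
      (fun i => (s i : Fin l)) (fun i => (s i : Fin l)) = 1
    rw [Units.mul_inv]
    exact Matrix.submatrix_one _ (Subtype.val_injective.comp s.injective)
  · ext i j
    have h : ((U : Matrix (Fin l) (Fin l) R) * E) (s i) j = 0 := by
      rw [hU.eq, Matrix.selector, Matrix.diagonal_mul, if_neg (s i).2, zero_mul]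
    exact h

/-- If `F` has normal rank `r` and `J_r(F) = R`, there is a ZLP matrix
`H ∈ R^{(l-r)×l}` with `H * F = 0`. -/
theorem statement1 {K : Type*} [Field K] {n l m r : ℕ}
    (F : Matrix (Fin l) (Fin m) (MvPolynomial (Fin n) K))
    (hrank : normalRank F = r)
    (hJ : JEqTop r F) :
    ∃ H : Matrix (Fin (l - r)) (Fin l) (MvPolynomial (Fin n) K),
      ZLP H ∧ H * F = 0 := by
  obtain ⟨d, ⟨hd, -⟩, hspan⟩ := hJ
  obtain ⟨hd0, E, X, hE, hEF, hX⟩ := exists_idempotent_of_reduced_minors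
    (L := FractionRing (MvPolynomial (Fin n) K)) F hrank d hd hspan
  have hEr : (E.map (algebraMap (MvPolynomial (Fin n) K)
      (FractionRing (MvPolynomial (Fin n) K)))).rank = r := by
    refine le_antisymm ?_ ?_
    · rw [← hrank, normalRank]
      have h : algebraMap _ (FractionRing (MvPolynomial (Fin n) K)) d
          ∈ nonZeroDivisors (FractionRing (MvPolynomial (Fin n) K)) :=
        mem_nonZeroDivisors_of_ne_zero
          ((map_ne_zero_iff _ (FaithfulSMul.algebraMap_injective _ _)).mpr hd0)
      have hs : (d • E).map (algebraMap _ (FractionRing (MvPolynomial (Fin n) K)))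
          = algebraMap _ (FractionRing (MvPolynomial (Fin n) K)) d
            • E.map (algebraMap _ (FractionRing (MvPolynomial (Fin n) K))) := by
        ext i j
        exact map_mul (algebraMap (MvPolynomial (Fin n) K)
          (FractionRing (MvPolynomial (Fin n) K))) _ _
      rw [← Matrix.rank_smul_of_mem_nonZeroDivisors _ h, ← hs, hX, Matrix.map_mul]
      exact Matrix.rank_mul_le_left _ _
    · rw [← hrank, normalRank]
      conv_lhs => rw [← hEF, Matrix.map_mul]
      exact Matrix.rank_mul_le_left _ _
  obtain ⟨c, hc⟩ := Matrix.IdempotentsDiagonalizable.mvPolynomial n K l E hE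
  obtain ⟨H, hH, hHE⟩ := Matrix.exists_zlp_annihilator_of_isConj_selector
    (L := FractionRing (MvPolynomial (Fin n) K)) E c hc hEr
  exact ⟨H, hH, by rw [← hEF, ← Matrix.mul_assoc, hHE, Matrix.zero_mul]⟩
end

section
/- Let F, A, B ∈ R^{l×l} with F = A · B, where R = K[x_1,...,x_n], and fix k with 1 ≤ k ≤ l such that d_k(F) ≠ 0 (i.e., F has normal rank ≥ k). If d_k(A) is associated to d_k(F) and J_k(F) = R, then J_k(A) = R, d_k(B) is a unit of R (a nonzero constant), and J_k(B) = R. -/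
open Matrix MvPolynomial

/-- The determinant of a product, expanded multilinearly in the rows of the second factor. -/
theorem det_mul_eq_sum_prod_mul_det_submatrix {R : Type*} [CommRing R] {k l : ℕ}
    (M : Matrix (Fin k) (Fin l) R) (N : Matrix (Fin l) (Fin k) R) :
    (M * N).det = ∑ f : Fin k → Fin l, (∏ i, M i (f i)) * (N.submatrix f id).det := by
  have h : M * N = fun i => ∑ j, M i j • N j := by
    ext i j
    simp [Matrix.mul_apply, Finset.sum_apply]
  rw [h]
  change detRowAlternating.toMultilinearMap (fun i => ∑ j, M i j • N j) = _
  rw [MultilinearMap.map_sum]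
  refine Finset.sum_congr rfl fun f _ => ?_
  rw [MultilinearMap.map_smul_univ]
  rfl

/-- The Cauchy–Binet formula. -/
theorem det_mul_eq_sum_orderEmb {R : Type*} [CommRing R] {k l : ℕ}
    (M : Matrix (Fin k) (Fin l) R) (N : Matrix (Fin l) (Fin k) R) :
    (M * N).det =
      ∑ e : Fin k ↪o Fin l, (M.submatrix id e).det * (N.submatrix e id).det := by
  classical
  have key : ∀ e : Fin k ↪o Fin l, (M.submatrix id e).det * (N.submatrix e id).det =
      ∑ σ : Equiv.Perm (Fin k), (∏ i, M i (e (σ i))) * (N.submatrix (e ∘ σ) id).det := by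
    intro e
    rw [← det_transpose (M.submatrix id e), det_apply', Finset.sum_mul]
    refine Finset.sum_congr rfl fun σ _ => ?_
    have h : (N.submatrix (e ∘ σ) id).det =
        (Equiv.Perm.sign σ : R) * (N.submatrix e id).det := by
      rw [← det_permute]
      rfl
    rw [h]
    simp only [transpose_apply, submatrix_apply, id]
    ring
  rw [det_mul_eq_sum_prod_mul_det_submatrix, Finset.sum_congr rfl fun e _ => key e,
    ← Fintype.sum_prod_type']
  symm
  refine Finset.sum_of_injOn (fun p : (Fin k ↪o Fin l) × Equiv.Perm (Fin k) => p.1 ∘ p.2)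
    ?_ (by simp) ?_ fun _ _ => rfl
  · rintro ⟨e, σ⟩ - ⟨e', σ'⟩ - h
    have hr : Set.range e = Set.range e' := by
      have := congrArg Set.range h
      simpa [Set.range_comp] using this
    obtain rfl : e = e' := OrderEmbedding.range_inj.mp hr
    refine Prod.ext rfl (Equiv.ext fun i => e.injective (congrFun h i))
  · intro f _ hf
    have hinj : ¬ Function.Injective f := by
      intro hinj
      refine hf ⟨⟨OrderEmbedding.ofStrictMono (f ∘ Tuple.sort f)
        ((Tuple.monotone_sort f).strictMono_of_injective
          (hinj.comp (Tuple.sort f).injective)), (Tuple.sort f)⁻¹⟩, by simp, ?_⟩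
      ext i
      simp
    obtain ⟨i, j, hij, hne⟩ := Function.not_injective_iff.mp hinj
    rw [det_zero_of_row_eq hne (by ext; simp [hij]), mul_zero]

/-- Each minor of a product is a sum of products of minors of the factors of the same order. -/
theorem exists_sum_mul_of_mem_minorsSet_mul {R : Type*} [CommRing R] {k l m p : ℕ}
    (A : Matrix (Fin l) (Fin m) R) (B : Matrix (Fin m) (Fin p) R)
    {c : R} (hc : c ∈ minorsSet k (A * B)) :
    ∃ a b : (Fin k ↪o Fin m) → R, (∀ e, a e ∈ minorsSet k A) ∧ (∀ e, b e ∈ minorsSet k B) ∧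
      c = ∑ e, a e * b e := by
  obtain ⟨ri, ci, hri, hci, rfl⟩ := hc
  refine ⟨fun e => (A.submatrix ri e).det, fun e => (B.submatrix e ci).det,
    fun e => ⟨ri, e, hri, e.injective, rfl⟩, fun e => ⟨e, ci, e.injective, hci, rfl⟩, ?_⟩
  rw [submatrix_mul A B ri id ci Function.bijective_id, det_mul_eq_sum_orderEmb]
  rfl

/-- If `F = A * B`, `d_k(F) ≠ 0`, `d_k(A)` is associated to `d_k(F)` and
`J_k(F) = R`, then `J_k(A) = R`, `d_k(B)` is a unit, and `J_k(B) = R`. -/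
theorem statement2 {K : Type*} [Field K] {n l : ℕ} {k : ℕ}
    (hk1 : 1 ≤ k) (hkl : k ≤ l)
    (F A B : Matrix (Fin l) (Fin l) (MvPolynomial (Fin n) K))
    (hF : F = A * B)
    (dF dA : MvPolynomial (Fin n) K)
    (hdF : IsGcdMinors k F dF) (hdF0 : dF ≠ 0)
    (hdA : IsGcdMinors k A dA)
    (hassoc : Associated dA dF)
    (hJ : JEqTop k F) :
    JEqTop k A ∧ (∀ dB, IsGcdMinors k B dB → IsUnit dB) ∧ JEqTop k B := by
  subst hF
  obtain ⟨d, hd, hspan⟩ := hJ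
  have hddA : d ∣ dA := (hdF.2 d hd.1).trans hassoc.symm.dvd
  have hdAd : dA ∣ d := hassoc.dvd.trans (hd.2 dF hdF.1)
  have hd0 : d ≠ 0 := fun h => hdF0 (zero_dvd_iff.mp (h ▸ hdF.2 d hd.1))
  have hgA : IsGcdMinors k A d :=
    ⟨fun a ha => hddA.trans (hdA.1 a ha), fun e he => (hdA.2 e he).trans hdAd⟩
  have hsum : ∀ c, d * c ∈ minorsSet k (A * B) → ∃ a b : (Fin k ↪o Fin l) → _,
      (∀ e, d * a e ∈ minorsSet k A) ∧ (∀ e, b e ∈ minorsSet k B) ∧ c = ∑ e, a e * b e := by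
    intro c hc
    obtain ⟨a, b, ha, hb, hab⟩ := exists_sum_mul_of_mem_minorsSet_mul A B hc
    choose a' ha' using fun e => hgA.1 (a e) (ha e)
    refine ⟨a', b, fun e => ha' e ▸ ha e, hb, mul_left_cancel₀ hd0 ?_⟩
    rw [hab, Finset.mul_sum]
    exact Finset.sum_congr rfl fun e _ => by rw [ha' e, mul_assoc]
  have hB : Ideal.span (minorsSet k B) = ⊤ := by
    refine top_le_iff.mp (hspan ▸ Ideal.span_le.mpr fun c hc => ?_)
    obtain ⟨a, b, -, hb, rfl⟩ := hsum c hc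
    exact Ideal.sum_mem _ fun e _ => Ideal.mul_mem_left _ _ (Ideal.subset_span (hb e))
  have hunit : ∀ e, (∀ b ∈ minorsSet k B, e ∣ b) → IsUnit e := fun e he =>
    Ideal.span_singleton_eq_top.mp <| top_le_iff.mp <| hB ▸ Ideal.span_le.mpr fun b hb =>
      Ideal.mem_span_singleton.mpr (he b hb)
  refine ⟨⟨d, hgA, ?_⟩, fun dB hdB => hunit dB hdB.1,
    1, ⟨fun _ _ => one_dvd _, fun e he => (hunit e he).dvd⟩, ?_⟩
  · refine top_le_iff.mp (hspan ▸ Ideal.span_le.mpr fun c hc => ?_)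
    obtain ⟨a, b, ha, -, rfl⟩ := hsum c hc
    exact Ideal.sum_mem _ fun e _ => Ideal.mul_mem_right _ _ (Ideal.subset_span (ha e))
  · simpa only [one_mul, Set.ofPred_mem_eq] using hB
end

section
/- Let F(x_1,...,x_n) ∈ R^{l×m} have normal rank r, and suppose the greatest common divisor d(x_1,...,x_n) of the r×r minors of F satisfies d(0,x_2,...,x_n) ≠ 0. Enumerate the r×r minors of F(x_1,...,x_n) and of F(0,x_2,...,x_n) by the same choices of row and column index sets, and let b_1,...,b_q be the reduced r-th order minors of F(x_1,...,x_n) and c_1,...,c_q the reduced r-th order minors of F(0,x_2,...,x_n). Then for each i = 1,...,q, the polynomial c_i(x_2,...,x_n) divides b_i(0,x_2,...,x_n) in K[x_2,...,x_n]. -/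
open Matrix MvPolynomial

/-- Let `F` have normal rank `rk` and let `d` be a g.c.d. of its `rk × rk`
minors with `d(0,x₂,…,xₙ) ≠ 0`.  For any common choice of row/column index sets, the
corresponding reduced `rk`-th order minor `c` of `F(0,x₂,…,xₙ)` divides the evaluation at
`x₁ = 0` of the corresponding reduced `rk`-th order minor `b` of `F`. -/
theorem statement3 {K : Type*} [Field K] {n l m : ℕ}
    (v1 : Fin n) (hv1 : (v1 : ℕ) = 0)
    (F : Matrix (Fin l) (Fin m) (MvPolynomial (Fin n) K))
    (rk : ℕ) (hrank : normalRank F = rk)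
    (φ : MvPolynomial (Fin n) K →ₐ[K] MvPolynomial (Fin n) K)
    (hφ : φ = MvPolynomial.aeval
      (fun j : Fin n => if j = v1 then 0 else MvPolynomial.X j))
    (d d' : MvPolynomial (Fin n) K)
    (hd : IsGcdMinors rk F d) (hd' : IsGcdMinors rk (F.map ⇑φ) d')
    (hd0 : φ d ≠ 0)
    (ri : Fin rk → Fin l) (ci : Fin rk → Fin m)
    (hri : Function.Injective ri) (hci : Function.Injective ci)
    (b c : MvPolynomial (Fin n) K)
    (hb : (F.submatrix ri ci).det = d * b)
    (hc : ((F.map ⇑φ).submatrix ri ci).det = d' * c) :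
    c ∣ φ b := by
  have map_minor (r : Fin rk → Fin l) (s : Fin rk → Fin m) :
      ((F.map ⇑φ).submatrix r s).det = φ (F.submatrix r s).det := by
    rw [AlgHom.map_det]
    rfl
  have hdvd : φ d ∣ d' := by
    refine hd'.2 _ ?_
    rintro _ ⟨r, s, hr, hs, rfl⟩
    rw [map_minor]
    exact map_dvd φ (hd.1 _ ⟨r, s, hr, hs, rfl⟩)
  obtain ⟨e, rfl⟩ := hdvd
  rw [map_minor, hb, map_mul, mul_assoc] at hc
  exact ⟨e, by rw [mul_left_cancel₀ hd0 hc, mul_comm]⟩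
end

section
/- Let F ∈ R^{l×m} (l ≤ m) be of full row rank with d_l(F) associated to x_1^p · x_2^q for positive integers p, q, and let i ∈ {1,2}. If x_i does not divide d_{l−r}(F), J_{l−r}(F) = R, and x_i divides d_{l−r+1}(F), then there exist a unimodular matrix W ∈ R^{l×l} whose entries do not involve the variable x_i (i.e., W has entries in K[x_1,...,x_n] with x_i omitted) and a matrix F_1 ∈ R^{l×m} such that W · F = diag(1,...,1, x_i,...,x_i) · F_1, where the diagonal matrix has l−r entries equal to 1 followed by r entries equal to x_i. -/
open Matrix MvPolynomial

/-- Two vectors are `GLRel`-related if an invertible matrix maps the first one to the second. -/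
def GLRel {ι A : Type*} [Fintype ι] [DecidableEq ι] [CommRing A] (v w : ι → A) : Prop :=
  ∃ M : (Matrix ι ι A)ˣ, M.1 *ᵥ v = w

namespace GLRel

variable {ι A B : Type*} [Fintype ι] [DecidableEq ι] [CommRing A] [CommRing B]

theorem refl (v : ι → A) : GLRel v v := ⟨1, by simp⟩

theorem symm {v w : ι → A} (h : GLRel v w) : GLRel w v := by
  obtain ⟨M, rfl⟩ := h
  exact ⟨M⁻¹, by simp [Matrix.mulVec_mulVec]⟩

theorem trans {u v w : ι → A} (h : GLRel u v) (h' : GLRel v w) : GLRel u w := by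
  obtain ⟨M, rfl⟩ := h
  obtain ⟨N, rfl⟩ := h'
  exact ⟨N * M, by simp [Matrix.mulVec_mulVec]⟩

theorem map {v w : ι → A} (h : GLRel v w) (f : A →+* B) : GLRel (f ∘ v) (f ∘ w) := by
  obtain ⟨M, rfl⟩ := h
  refine ⟨Units.map f.mapMatrix.toMonoidHom M, ?_⟩
  ext i
  simp [RingHom.map_mulVec]

theorem of_linearEquiv (e : (ι → A) ≃ₗ[A] (ι → A)) (v : ι → A) : GLRel v (e v) := by
  refine ⟨⟨LinearMap.toMatrix' e.toLinearMap, LinearMap.toMatrix' e.symm.toLinearMap, ?_, ?_⟩, ?_⟩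
  · rw [← LinearMap.toMatrix'_comp]; simp
  · rw [← LinearMap.toMatrix'_comp]; simp
  · simp [LinearMap.toMatrix'_mulVec]

theorem exists_linearEquiv {v w : ι → A} (h : GLRel v w) :
    ∃ e : (ι → A) ≃ₗ[A] (ι → A), e v = w := by
  obtain ⟨M, rfl⟩ := h
  refine ⟨LinearEquiv.ofLinearMap (Matrix.toLin' M.1) (Matrix.toLin' M⁻¹.1) ?_ ?_, by simp⟩
  · rw [← Matrix.toLin'_mul]; simp
  · rw [← Matrix.toLin'_mul]; simp

theorem add_smul (φ u v : ι → A) (h : φ ⬝ᵥ u = 0) : GLRel v (v + (φ ⬝ᵥ v) • u) := by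
  have key (x : ι → A) (c : A) (hx : φ ⬝ᵥ x = c) : (1 + vecMulVec u φ) *ᵥ x = x + c • u := by
    rw [add_mulVec, one_mulVec, vecMulVec_mulVec, hx]
    ext i
    simp
  have hz : vecMulVec u φ * vecMulVec u φ = 0 := by
    rw [vecMulVec_mul_vecMulVec, h]
    ext; simp [vecMulVec]
  refine ⟨⟨1 + vecMulVec u φ, 1 - vecMulVec u φ, ?_, ?_⟩, key v _ rfl⟩
  · rw [mul_sub, add_mul, add_mul, hz]; simp
  · rw [mul_add, sub_mul, sub_mul, hz]; simp

/-- The action of a `2 × 2` matrix on two coordinates of a vector. -/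
def twoCoord (i j : ι) (a b c d : A) : (ι → A) →ₗ[A] (ι → A) where
  toFun x k := if k = i then a * x i + b * x j else if k = j then c * x i + d * x j else x k
  map_add' x y := by
    ext k
    simp only [Pi.add_apply]
    split_ifs <;> ring
  map_smul' r x := by
    ext k
    simp only [Pi.smul_apply, smul_eq_mul, RingHom.id_apply]
    split_ifs <;> ring

omit [Fintype ι] in
theorem twoCoord_comp {i j : ι} (hij : i ≠ j) {a b c d : A} (h : a * d - b * c = 1) :
    twoCoord i j a b c d ∘ₗ twoCoord i j d (-b) (-c) a = LinearMap.id := by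
  refine LinearMap.ext fun x ↦ funext fun k ↦ ?_
  simp only [twoCoord, LinearMap.comp_apply, LinearMap.coe_mk, AddHom.coe_mk, if_true,
    hij.symm, if_false, LinearMap.id_apply]
  split_ifs with h1 h2
  · subst h1; linear_combination x k * h
  · subst h2; linear_combination x k * h
  · rfl

theorem of_twoCoord {i j : ι} (hij : i ≠ j) {a b c d : A} (h : a * d - b * c = 1) (v : ι → A) :
    GLRel v (twoCoord i j a b c d v) :=
  of_linearEquiv (LinearEquiv.ofLinearMap _ (twoCoord i j d (-b) (-c) a) (twoCoord_comp hij h) (by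
    have := twoCoord_comp (i := i) (j := j) hij (a := d) (b := -b) (c := -c) (d := a)
      (by linear_combination h)
    simpa using this)) v

/-- A vector with an invertible entry can be moved to any standard basis vector. -/
theorem single_of_isUnit {v : ι → A} {j : ι} (h : IsUnit (v j)) (i : ι) :
    GLRel v (Pi.single i 1) := by
  obtain ⟨u, hu⟩ := h
  have h1 : GLRel v (u⁻¹ • v) :=
    of_linearEquiv (DistribMulAction.toLinearEquiv A (ι → A) u⁻¹) v
  set w := u⁻¹ • v with hw
  have hwj : w j = 1 := by simp [hw, ← hu, Units.smul_def]
  have h2 : GLRel w (Pi.single j 1) := by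
    have := add_smul (Pi.single j 1) (Pi.single j 1 - w) w (by simp [hwj])
    simpa [hwj] using this
  have h3 : GLRel (Pi.single j (1 : A)) (Pi.single i 1) := by
    have := of_linearEquiv (LinearEquiv.funCongrLeft A A (Equiv.swap i j)) (Pi.single j (1 : A))
    convert this using 1
    ext k
    simp only [LinearEquiv.funCongrLeft_apply, LinearMap.funLeft_apply, Pi.single_apply,
      Equiv.swap_apply_eq_iff, Equiv.swap_apply_right]
  exact (h1.trans h2).trans h3

end GLRel

section Suslin
open Polynomial

theorem exists_isCoprime_add_mul {P : Type*} [CommRing P] [IsDomain P] [IsPrincipalIdealRing P]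
    {a : P} (ha : a ≠ 0) (b g : P) (h : ∃ u v : P, u * a + v * b + g = 1) :
    ∃ t, IsCoprime a (b + t * g) := by
  obtain ⟨u, v, h⟩ := h
  suffices ∀ a' : P, a' ≠ 0 → a' ∣ a → ∃ t, IsCoprime a' (b + t * g) from this a ha dvd_rfl
  intro a'
  induction a' using UniqueFactorizationMonoid.induction_on_prime with
  | h₁ => simp
  | h₂ x hx => exact fun _ _ ↦ ⟨0, (let ⟨u, hu⟩ := hx; ⟨↑u⁻¹, 0, by simp [← hu]⟩)⟩
  | h₃ x p hx hp ih =>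
    intro _ hdvd
    obtain ⟨t, ht⟩ := ih hx ((dvd_mul_left x p).trans hdvd)
    have hcop (y : P) : IsCoprime p y ↔ ¬ p ∣ y := hp.irreducible.coprime_iff_not_dvd
    by_cases hpt : p ∣ b + t * g
    · have hpx : ¬ p ∣ x := fun hpx ↦ hp.not_isUnit (ht.isUnit_of_dvd' hpx hpt)
      have hpg : ¬ p ∣ g := fun hpg ↦ by
        have hpb : p ∣ b := (dvd_add_left (hpg.mul_left t)).1 hpt
        have hpa : p ∣ a := (dvd_mul_right p x).trans hdvd
        exact hp.not_isUnit (isUnit_of_dvd_one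
          (h ▸ dvd_add (dvd_add (hpa.mul_left u) (hpb.mul_left v)) hpg))
      refine ⟨t + x, IsCoprime.mul_left ?_ ?_⟩
      · rw [hcop]
        intro hd
        have : p ∣ x * g := by
          have := (dvd_sub hd hpt)
          ring_nf at this
          exact this
        exact (hp.dvd_or_dvd this).elim hpx hpg
      · obtain ⟨r, s, hrs⟩ := ht
        exact ⟨r - s * g, s, by linear_combination hrs⟩
    · exact ⟨t, IsCoprime.mul_left ((hcop _).2 hpt) ht⟩

theorem exists_C_mem_span_pair {A : Type*} [CommRing A] (m : Ideal A) [hm : m.IsMaximal]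
    {p q : A[X]} (hp : p.Monic)
    (h : IsCoprime (p.map (Ideal.Quotient.mk m)) (q.map (Ideal.Quotient.mk m))) :
    ∃ c ∉ m, ∃ g₁ g₂ : A[X], g₁ * p + g₂ * q = Polynomial.C c := by
  suffices ∃ c ∉ m, Polynomial.C c ∈ Ideal.span {p, q} by
    obtain ⟨c, hc, hcI⟩ := this
    obtain ⟨g₁, g₂, hg⟩ := Ideal.mem_span_pair.1 hcI
    exact ⟨c, hc, g₁, g₂, hg⟩
  by_contra! hcon
  set I : Ideal A[X] := Ideal.span {p, q} with hI
  have hpI : p ∈ I := Ideal.subset_span (by simp)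
  have hqI : q ∈ I := Ideal.subset_span (by simp)
  have h_integral : Algebra.IsIntegral A (A[X] ⧸ I) := ⟨hp.quotient_isIntegral hpI⟩
  obtain ⟨Q, hQ, hQm⟩ := Ideal.exists_ideal_over_maximal_of_isIntegral (S := A[X] ⧸ I) m (by
    intro c hc
    by_contra hcm
    refine hcon c hcm ?_
    rw [RingHom.mem_ker] at hc
    exact Ideal.Quotient.eq_zero_iff_mem.1 hc)
  set Q' := Q.comap (Ideal.Quotient.mk I)
  have hIQ : I ≤ Q' := by
    intro x hx
    rw [Ideal.mem_comap, Ideal.Quotient.eq_zero_iff_mem.2 hx]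
    exact Q.zero_mem
  have hmQ : m.map Polynomial.C ≤ Q' := by
    rw [Ideal.map_le_iff_le_comap, ← hQm]
    exact fun x hx ↦ hx
  obtain ⟨u, w, huw⟩ := h
  obtain ⟨u, rfl⟩ := Polynomial.map_surjective _ Ideal.Quotient.mk_surjective u
  obtain ⟨w, rfl⟩ := Polynomial.map_surjective _ Ideal.Quotient.mk_surjective w
  have hk : u * p + w * q - 1 ∈ m.map (Polynomial.C : A →+* A[X]) := by
    rw [← Ideal.mk_ker (I := m), ← Polynomial.ker_mapRingHom]
    simp [RingHom.mem_ker, huw]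
  have h1 : (1 : A[X]) ∈ Q' := by
    have := Q'.sub_mem (Q'.add_mem (Q'.mul_mem_left u (hIQ hpI)) (Q'.mul_mem_left w (hIQ hqI)))
      (hmQ hk)
    simpa using this
  exact hQ.ne_top ((Ideal.eq_top_iff_one _).2 (by simpa [Q'] using h1))

theorem Polynomial.exists_comp_add_mul {A : Type*} [CommRing A] (p b c : A[X]) :
    ∃ r, p.comp (b + c) = p.comp b + c * r := by
  have := Polynomial.sub_dvd_eval_sub (b + c) b (p.map Polynomial.C)
  obtain ⟨r, hr⟩ := this
  refine ⟨r, ?_⟩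
  rw [Polynomial.eval_map, Polynomial.eval_map] at hr
  rw [Polynomial.comp, Polynomial.comp]
  linear_combination hr
end Suslin

section Suslin
open Polynomial

variable {ι A : Type*} [Fintype ι] [DecidableEq ι] [CommRing A]

/-- If `c` lies in the ideal generated by two entries of `f`, then the `GL`-class of `f(b)` depends
only on `b` modulo `c`. -/
theorem GLRel.comp_add_C_mul [IsDomain A] {f : ι → A[X]} {i j : ι} (hij : i ≠ j) {c : A}
    (hc : c ≠ 0) {g₁ g₂ : A[X]} (hg : g₁ * f i + g₂ * f j = Polynomial.C c) (b d : A[X]) :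
    GLRel (fun k ↦ (f k).comp b) (fun k ↦ (f k).comp (b + Polynomial.C c * d)) := by
  have hC : (Polynomial.C c : A[X]) ≠ 0 := by simpa using hc
  have hex (p : A[X]) : ∃ r, p.comp (b + Polynomial.C c * d) = p.comp b + Polynomial.C c * r := by
    obtain ⟨r, hr⟩ := Polynomial.exists_comp_add_mul p b (Polynomial.C c * d)
    exact ⟨d * r, by rw [hr]; ring⟩
  choose ρ hρ using hex
  have e1 : g₁.comp b * (f i).comp b + g₂.comp b * (f j).comp b = Polynomial.C c := by
    simpa using congrArg (fun p : A[X] ↦ p.comp b) hg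
  have e2 : g₁.comp (b + Polynomial.C c * d) * (f i).comp (b + Polynomial.C c * d) +
      g₂.comp (b + Polynomial.C c * d) * (f j).comp (b + Polynomial.C c * d) = Polynomial.C c := by
    simpa using congrArg (fun p : A[X] ↦ p.comp (b + Polynomial.C c * d)) hg
  have hdet : ρ (f i) * g₁.comp b + ρ g₁ * (f i).comp b + ρ (f j) * g₂.comp b
      + ρ g₂ * (f j).comp b
      + Polynomial.C c * (ρ (f i) * ρ g₁ + ρ (f j) * ρ g₂) = 0 := by
    rw [hρ g₁, hρ g₂, hρ (f i), hρ (f j)] at e2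
    refine mul_left_cancel₀ hC ?_
    linear_combination e2 - e1
  have h1 := GLRel.of_twoCoord hij (v := fun k ↦ (f k).comp b)
    (a := 1 + (ρ (f i) * g₁.comp b + ρ g₂ * (f j).comp b))
    (b := ρ (f i) * g₂.comp b - ρ g₂ * (f i).comp b)
    (c := ρ (f j) * g₁.comp b - ρ g₁ * (f j).comp b)
    (d := 1 + (ρ (f j) * g₂.comp b + ρ g₁ * (f i).comp b))
    (by linear_combination hdet + (ρ (f i) * ρ g₁ + ρ (f j) * ρ g₂) * e1)
  obtain ⟨w, hw⟩ : ∃ w, w = GLRel.twoCoord i j (1 + (ρ (f i) * g₁.comp b + ρ g₂ * (f j).comp b))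
    (ρ (f i) * g₂.comp b - ρ g₂ * (f i).comp b) (ρ (f j) * g₁.comp b - ρ g₁ * (f j).comp b)
    (1 + (ρ (f j) * g₂.comp b + ρ g₁ * (f i).comp b)) (fun k ↦ (f k).comp b) := ⟨_, rfl⟩
  rw [← hw] at h1
  have hwi : w i = (f i).comp (b + Polynomial.C c * d) := by
    rw [hρ, hw]
    simp only [GLRel.twoCoord, LinearMap.coe_mk, AddHom.coe_mk, if_true]
    linear_combination ρ (f i) * e1
  have hwj : w j = (f j).comp (b + Polynomial.C c * d) := by
    rw [hρ, hw]
    simp only [GLRel.twoCoord, LinearMap.coe_mk, AddHom.coe_mk, if_true, hij.symm, if_false]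
    linear_combination ρ (f j) * e1
  refine h1.trans ?_
  have h2 := GLRel.add_smul
    (Pi.single i (g₁.comp (b + Polynomial.C c * d)) +
      Pi.single j (g₂.comp (b + Polynomial.C c * d)))
    (fun k ↦ if k = i then 0 else if k = j then 0 else ρ (f k)) w
    (by simp [add_dotProduct, hij.symm])
  convert h2 using 1
  funext k
  simp only [add_dotProduct, single_dotProduct, hwi, hwj, e2, Pi.add_apply, Pi.smul_apply]
  split_ifs with hi hj
  · subst hi; simp [hwi]
  · subst hj; simp [hwj]
  · rw [hρ, hw]
    simp [GLRel.twoCoord, hi, hj]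

/-- **Suslin's theorem**: a unimodular vector over `A[X]` with a monic entry can be moved to its
value at `0` by an invertible matrix. -/
theorem GLRel.eval_zero [IsDomain A] {f u : ι → A[X]} (hu : u ⬝ᵥ f = 1) {i : ι}
    (hi : (f i).Monic) : GLRel (fun k ↦ Polynomial.C ((f k).eval 0)) f := by
  let J : Ideal A :=
    { carrier := {c | ∀ b d : A[X],
        GLRel (fun k ↦ (f k).comp b) (fun k ↦ (f k).comp (b + Polynomial.C c * d))}
      add_mem' := by
        intro c c' hc hc' b d
        have := (hc b d).trans (hc' (b + Polynomial.C c * d) d)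
        simpa [add_assoc, add_mul] using this
      zero_mem' := by
        intro b d
        simpa using GLRel.refl _
      smul_mem' := by
        intro a c hc b d
        have := hc b (Polynomial.C a * d)
        convert this using 4
        simp only [smul_eq_mul, Polynomial.C_mul]
        ring }
  suffices hJ : J = ⊤ by
    have h1 : (1 : A) ∈ J := by rw [hJ]; trivial
    have := h1 0 X
    simpa [Polynomial.C_eq_natCast] using this
  by_contra hJ
  obtain ⟨m, hm, hJm⟩ := Ideal.exists_le_maximal J hJ
  by_cases hex : ∃ j, j ≠ i
  · obtain ⟨j, hj⟩ := hex
    set π := Polynomial.mapRingHom (Ideal.Quotient.mk m) with hπ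
    let : Field (A ⧸ m) := Ideal.Quotient.field m
    let S := (Finset.univ.erase i).erase j
    let g := ∑ k ∈ S, u k * f k
    have hsum : u i * f i + u j * f j + g = 1 := by
      rw [← hu, dotProduct, ← Finset.add_sum_erase _ _ (Finset.mem_univ i),
        ← Finset.add_sum_erase _ _ (Finset.mem_erase.2 ⟨hj, Finset.mem_univ j⟩)]
      ring
    obtain ⟨t, ht⟩ := exists_isCoprime_add_mul (a := π (f i)) (hi.map _).ne_zero (π (f j)) (π g)
      ⟨π (u i), π (u j), by simp only [← map_mul, ← map_add, hsum, map_one]⟩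
    obtain ⟨t, rfl⟩ := Polynomial.map_surjective _ Ideal.Quotient.mk_surjective t
    obtain ⟨c, hcm, g₁, g₂, hg⟩ := exists_C_mem_span_pair m hi (q := f j + t * g) (by
      simpa [hπ] using ht)
    refine hcm (hJm fun b d ↦ ?_)
    let f' : ι → A[X] := f + (t * g) • Pi.single j 1
    have hf'i : f' i = f i := by simp [f', hj.symm]
    have hf'j : f' j = f j + t * g := by simp [f']
    have hrel (b : A[X]) : GLRel (fun k ↦ (f k).comp b) (fun k ↦ (f' k).comp b) := by
      have := GLRel.add_smul (fun k ↦ if k ∈ S then (t * u k).comp b else 0) (Pi.single j 1)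
        (fun k ↦ (f k).comp b) (by simp [S])
      have hg : g.comp b = ∑ k ∈ S, (u k).comp b * (f k).comp b := by
        simp only [g, ← Polynomial.coe_compRingHom_apply, map_sum, map_mul]
      convert this using 1
      funext k
      simp only [f', dotProduct, ite_mul, zero_mul, Finset.sum_ite_mem, Finset.univ_inter,
        Pi.add_apply, Pi.smul_apply, smul_eq_mul, Polynomial.add_comp,
        Pi.single_apply, Polynomial.mul_comp]
      split_ifs <;> simp [hg, Finset.mul_sum, mul_assoc]
    refine (hrel _).trans (GLRel.trans ?_ (hrel _).symm)
    refine GLRel.comp_add_C_mul hj.symm ?_ (g₁ := g₁) (g₂ := g₂) ?_ b d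
    · rintro rfl
      exact hcm m.zero_mem
    · rw [hf'i, hf'j, hg]
  · push Not at hex
    have h1 : f i = 1 := by
      refine hi.eq_one_of_isUnit (IsUnit.of_mul_eq_one (u i) ?_)
      rw [← hu, dotProduct, Finset.sum_eq_single i (fun k _ hk ↦ absurd (hex k) hk)
        (fun h ↦ absurd (Finset.mem_univ i) h), mul_comm]
    refine hm.ne_top ((Ideal.eq_top_iff_one _).2 (hJm fun b d ↦ ?_))
    have : ∀ k, f k = 1 := fun k ↦ hex k ▸ h1
    simpa [this] using GLRel.refl _
end Suslin

section Nagata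

variable {K : Type*} [Field K] {n : ℕ}

/-- The substitution `X i ↦ X i + c • X 0 ^ N ^ i` for `i ≠ 0`, fixing `X 0`. -/
noncomputable def nagataHom (n N : ℕ) (c : K) :
    MvPolynomial (Fin (n + 1)) K →ₐ[K] MvPolynomial (Fin (n + 1)) K :=
  aeval fun i ↦ if i = 0 then X 0 else X i + c • X 0 ^ N ^ i.1

theorem nagataHom_comp_neg (N : ℕ) (c : K) :
    (nagataHom n N c).comp (nagataHom n N (-c)) = AlgHom.id _ _ := by
  unfold nagataHom
  rw [comp_aeval, ← MvPolynomial.aeval_X_left]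
  ext i v
  cases i using Fin.cases <;> simp

/-- The automorphism `X i ↦ X i + X 0 ^ N ^ i` for `i ≠ 0`, fixing `X 0`. -/
noncomputable def nagataEquiv (K : Type*) [Field K] (n N : ℕ) :
    MvPolynomial (Fin (n + 1)) K ≃ₐ[K] MvPolynomial (Fin (n + 1)) K :=
  AlgEquiv.ofAlgHom (nagataHom n N 1) (nagataHom n N (-1))
    (nagataHom_comp_neg N 1) (by simpa using nagataHom_comp_neg N (-1 : K))

theorem nagataEquiv_apply (N : ℕ) (f : MvPolynomial (Fin (n + 1)) K) :
    nagataEquiv K n N f = nagataHom n N 1 f := rfl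

theorem sum_pow_mul_ne {N : ℕ} (hN : 1 < N) {v w : Fin (n + 1) →₀ ℕ} (vlt : ∀ i, v i < N)
    (wlt : ∀ i, w i < N) (ne : v ≠ w) :
    ∑ i : Fin (n + 1), N ^ i.1 * v i ≠ ∑ i : Fin (n + 1), N ^ i.1 * w i := by
  intro h
  refine ne <| Finsupp.ext <| congrFun <| List.ofFn_inj.mp ?_
  apply Nat.ofDigits_inj_of_len_eq hN (by simp) (by simpa [Fin.forall_fin_succ] using vlt)
    (by simpa [Fin.forall_fin_succ] using wlt)
  simpa only [Nat.ofDigits_eq_sum_mapIdx, List.mapIdx_eq_ofFn, List.get_ofFn, List.length_ofFn,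
    Fin.val_cast, mul_comm, List.sum_ofFn] using! h

theorem degreeOf_zero_nagataEquiv {N : ℕ} (hN : 1 < N) (v : Fin (n + 1) →₀ ℕ) {a : K}
    (ha : a ≠ 0) :
    (nagataEquiv K n N (monomial v a)).degreeOf 0 = ∑ i : Fin (n + 1), N ^ i.1 * v i := by
  rw [← natDegree_finSuccEquiv, monomial_eq, Finsupp.prod_pow v fun a ↦ X a, nagataEquiv_apply,
    nagataHom]
  simp only [Fin.prod_univ_succ, Fin.sum_univ_succ, map_mul, map_prod, map_pow,
    MvPolynomial.aeval_C, MvPolynomial.aeval_X, if_pos, Fin.succ_ne_zero,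
    ite_false, one_smul, map_add, finSuccEquiv_X_zero, finSuccEquiv_X_succ, algebraMap_eq]
  have h (i : Fin n) :
      (Polynomial.C (X (R := K) i) + Polynomial.X ^ N ^ (i.succ).1) ^ v i.succ ≠ 0 :=
    pow_ne_zero (v i.succ) (by
      rw [add_comm]
      exact Polynomial.X_pow_add_C_ne_zero (Nat.pow_pos (by omega)) _)
  rw [Polynomial.natDegree_mul (by simp [ha]) (mul_ne_zero (by simp)
    (Finset.prod_ne_zero_iff.mpr (fun i _ ↦ h i))),
    Polynomial.natDegree_mul (by simp) (Finset.prod_ne_zero_iff.mpr (fun i _ ↦ h i)),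
    Polynomial.natDegree_prod _ _ (fun i _ ↦ h i), natDegree_finSuccEquiv, degreeOf_C]
  simpa only [Polynomial.natDegree_pow, zero_add, Polynomial.natDegree_X, mul_one, Fin.val_zero,
    pow_zero, one_mul, add_right_inj] using Finset.sum_congr rfl (fun i _ ↦ by
    rw [add_comm (Polynomial.C _), Polynomial.natDegree_X_pow_add_C, mul_comm])

theorem leadingCoeff_finSuccEquiv_nagataEquiv {N : ℕ} (hN : 1 < N) (v : Fin (n + 1) →₀ ℕ)
    (a : K) :
    (finSuccEquiv K n (nagataEquiv K n N (monomial v a))).leadingCoeff = algebraMap K _ a := by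
  rw [monomial_eq, Finsupp.prod_fintype]
  · simp only [map_mul, map_prod, Polynomial.leadingCoeff_mul, Polynomial.leadingCoeff_prod]
    rw [nagataEquiv_apply, algHom_C, algebraMap_eq, finSuccEquiv_apply,
      eval₂Hom_C, RingHom.coe_comp]
    simp only [nagataEquiv_apply, Function.comp_apply, Polynomial.leadingCoeff_C, map_pow,
      Polynomial.leadingCoeff_pow, algebraMap_eq]
    have : ∀ j, ((finSuccEquiv K n) (nagataHom n N 1 (X j))).leadingCoeff = 1 := fun j ↦ by
      by_cases h : j = 0
      · simp [h, nagataHom, finSuccEquiv_apply]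
      · simp only [nagataHom, aeval_eq_bind₁, bind₁_X_right, if_neg h, one_smul, map_add, map_pow]
        obtain ⟨i, rfl⟩ := Fin.exists_succ_eq.mpr h
        rw [finSuccEquiv_X_succ, finSuccEquiv_X_zero, add_comm,
          Polynomial.leadingCoeff_X_pow_add_C (Nat.pow_pos (by omega))]
    simp only [this, one_pow, Finset.prod_const_one, mul_one]
  exact fun i ↦ pow_zero _

/-- After a suitable automorphism, a nonzero polynomial is monic in `X 0` up to a unit. -/
theorem exists_isUnit_leadingCoeff_finSuccEquiv {f : MvPolynomial (Fin (n + 1)) K} (hf : f ≠ 0) :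
    ∃ T : MvPolynomial (Fin (n + 1)) K ≃ₐ[K] MvPolynomial (Fin (n + 1)) K,
      IsUnit (finSuccEquiv K n (T f)).leadingCoeff := by
  set N := 2 + f.totalDegree with hNdef
  have hN : 1 < N := by omega
  have hlt {v : Fin (n + 1) →₀ ℕ} (hv : v ∈ f.support) (i) : v i < N :=
    lt_of_le_of_lt ((monomial_le_degreeOf i hv).trans (degreeOf_le_totalDegree f i)) (by omega)
  set T := nagataEquiv K n N
  refine ⟨T, ?_⟩
  obtain ⟨v, vin, vs⟩ := Finset.exists_max_image f.support
    (fun v ↦ (T ((monomial v) (coeff v f))).degreeOf 0) (support_nonempty.mpr hf)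
  set h := fun w ↦ (MvPolynomial.monomial w) (coeff w f)
  simp only [← natDegree_finSuccEquiv] at vs
  replace vs : ∀ x ∈ f.support \ {v}, (finSuccEquiv K n (T (h x))).degree <
      (finSuccEquiv K n (T (h v))).degree := by
    intro x hx
    obtain ⟨h1, h2⟩ := Finset.mem_sdiff.mp hx
    apply Polynomial.degree_lt_degree <| lt_of_le_of_ne (vs x h1) ?_
    rw [natDegree_finSuccEquiv, natDegree_finSuccEquiv,
      degreeOf_zero_nagataEquiv hN _ (mem_support_iff.mp h1),
      degreeOf_zero_nagataEquiv hN _ (mem_support_iff.mp vin)]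
    exact sum_pow_mul_ne hN (hlt h1) (hlt vin) (by simpa using h2)
  have hcoeff : (finSuccEquiv K n (T (h v + ∑ x ∈ f.support \ {v}, h x))).leadingCoeff =
      (finSuccEquiv K n (T (h v))).leadingCoeff := by
    simp only [map_add, map_sum]
    rw [add_comm]
    apply Polynomial.leadingCoeff_add_of_degree_lt <|
      (lt_of_le_of_lt <| Polynomial.degree_sum_le _ _) ?_
    have h2 : h v ≠ 0 := by simpa [h] using mem_support_iff.mp vin
    replace h2 : (finSuccEquiv K n (T (h v))) ≠ 0 := fun eq ↦ h2 <|
      by simpa only [map_eq_zero_iff _ (AlgEquiv.injective _)] using eq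
    exact (Finset.sup_lt_iff <| Ne.bot_lt
      (fun x ↦ h2 <| Polynomial.degree_eq_bot.mp x)).mpr vs
  nth_rw 1 [← f.support_sum_monomial_coeff]
  rw [Finset.sum_eq_add_sum_sdiff_singleton_of_mem vin h]
  rw [leadingCoeff_finSuccEquiv_nagataEquiv hN] at hcoeff
  simpa only [hcoeff, algebraMap_eq] using (mem_support_iff.mp vin).isUnit.map MvPolynomial.C

end Nagata

/-- Unimodular vectors over a polynomial ring over a field are completable. -/
theorem GLRel.single_of_dotProduct_eq_one {K : Type*} [Field K] {n : ℕ} {ι : Type*} [Fintype ι]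
    [DecidableEq ι] {f u : ι → MvPolynomial (Fin n) K} (hu : u ⬝ᵥ f = 1) (i : ι) :
    GLRel f (Pi.single i 1) := by
  induction n with
  | zero =>
    obtain ⟨j, hj⟩ : ∃ j, f j ≠ 0 := by
      by_contra! h
      rw [show f = 0 from funext h] at hu
      simp at hu
    refine GLRel.single_of_isUnit (j := j) ?_ i
    have := (isEmptyRingEquiv K (Fin 0)).map_ne_zero_iff.2 hj
    exact (MulEquiv.isUnit_map (isEmptyRingEquiv K (Fin 0))).1 this.isUnit
  | succ n ih =>
    obtain ⟨j, hj⟩ : ∃ j, f j ≠ 0 := by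
      by_contra! h
      rw [show f = 0 from funext h] at hu
      simp at hu
    obtain ⟨T, hT⟩ := exists_isUnit_leadingCoeff_finSuccEquiv hj
    let e : MvPolynomial (Fin (n + 1)) K ≃+* Polynomial (MvPolynomial (Fin n) K) :=
      (T.trans (finSuccEquiv K n)).toRingEquiv
    obtain ⟨c, hc⟩ : IsUnit (e (f j)).leadingCoeff := hT
    have hu1 : (e ∘ u) ⬝ᵥ (e ∘ f) = 1 := by
      have := congrArg e hu
      simpa [dotProduct] using this
    let d : (Polynomial (MvPolynomial (Fin n) K))ˣ := Units.map Polynomial.C.toMonoidHom c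
    have hu2 : (d • (e ∘ u)) ⬝ᵥ (d⁻¹ • (e ∘ f)) = 1 := by
      rw [smul_dotProduct, dotProduct_smul, smul_smul, mul_inv_cancel, one_smul, hu1]
    have hmon : ((d⁻¹ • (e ∘ f)) j).Monic := by
      have : (d⁻¹ • (e ∘ f)) j = Polynomial.C (c⁻¹).1 * e (f j) := rfl
      rw [this, Polynomial.Monic, Polynomial.leadingCoeff_mul, ← hc]
      simp
    have h1 : GLRel (e ∘ f) (d⁻¹ • (e ∘ f)) :=
      GLRel.of_linearEquiv (DistribMulAction.toLinearEquiv _ _ d⁻¹) _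
    have h2 := (GLRel.eval_zero hu2 hmon).symm
    have h3 : GLRel (fun k ↦ ((d⁻¹ • (e ∘ f)) k).eval 0) (Pi.single i 1) := by
      refine ih (u := fun k ↦ ((d • (e ∘ u)) k).eval 0) ?_
      have := congrArg (Polynomial.eval 0) hu2
      simpa only [dotProduct, Polynomial.eval_finsetSum, Polynomial.eval_mul,
        Polynomial.eval_one] using this
    have h4 := ((h1.trans h2).trans (h3.map Polynomial.C)).map e.symm.toRingHom
    convert h4 using 1
    · ext k; simp
    · ext k
      simp only [Function.comp_apply, Pi.single_apply]
      split_ifs <;> simp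

section Cancellation

variable {K : Type*} [Field K] {n : ℕ}

theorem exists_linearEquiv_of_prod_self {N : Type*} [AddCommGroup N]
    [Module (MvPolynomial (Fin n) K) N] {t : ℕ}
    (ψ : (N × MvPolynomial (Fin n) K) ≃ₗ[MvPolynomial (Fin n) K]
      (Fin t → MvPolynomial (Fin n) K)) :
    ∃ t', Nonempty (N ≃ₗ[MvPolynomial (Fin n) K] (Fin t' → MvPolynomial (Fin n) K)) := by
  set A := MvPolynomial (Fin n) K
  rcases t with _ | t
  · exact absurd (ψ.injective (Subsingleton.elim (ψ (0, 1)) (ψ (0, 0)))) (by simp)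
  refine ⟨t, ?_⟩
  let φ : (Fin (t + 1) → A) →ₗ[A] A := LinearMap.snd A N A ∘ₗ ψ.symm.toLinearMap
  have hu : (fun i ↦ φ (Pi.single i 1)) ⬝ᵥ ψ (0, 1) = 1 := by
    have h1 : φ (ψ (0, 1)) = 1 := by simp [φ]
    conv_rhs => rw [← h1, LinearMap.pi_apply_eq_sum_univ φ]
    simp only [dotProduct, smul_eq_mul, mul_comm]
    refine Finset.sum_congr rfl fun i _ ↦ ?_
    congr 2
    ext j
    simp [Pi.single_apply, eq_comm]
  obtain ⟨e, he⟩ := (GLRel.single_of_dotProduct_eq_one hu 0).exists_linearEquiv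
  let χ := ψ.trans e
  have hχ (a : A) : χ (0, a) = Pi.single 0 a := by
    have : ((0, a) : N × A) = a • (0, 1) := by simp
    rw [this, map_smul, LinearEquiv.trans_apply, he]
    ext j
    simp [Pi.single_apply]
  let g : N →ₗ[A] (Fin t → A) := LinearMap.funLeft A A Fin.succ ∘ₗ χ.toLinearMap ∘ₗ
    LinearMap.inl A N A
  have hg (x : N) (i : Fin t) : g x i = χ (x, 0) i.succ := rfl
  refine ⟨LinearEquiv.ofBijective g ⟨?_, ?_⟩⟩
  · rw [injective_iff_map_eq_zero]
    intro x hx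
    have : χ (x, 0) = χ (0, χ (x, 0) 0) := by
      rw [hχ]
      refine funext fun j ↦ ?_
      cases j using Fin.cases with
      | zero => simp
      | succ j => rw [← hg, hx]; simp
    simpa using congrArg Prod.fst (χ.injective this)
  · intro y
    refine ⟨(χ.symm (Fin.cons 0 y)).1, funext fun i ↦ ?_⟩
    rw [hg]
    have : ((χ.symm (Fin.cons 0 y)).1, (0 : A)) =
        χ.symm (Fin.cons 0 y) - (0, (χ.symm (Fin.cons 0 y)).2) := by
      ext <;> simp
    rw [this, map_sub, hχ, LinearEquiv.apply_symm_apply]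
    simp

theorem exists_linearEquiv_of_prod_pi {s : ℕ} {N : Type*} [AddCommGroup N]
    [Module (MvPolynomial (Fin n) K) N] {t : ℕ}
    (ψ : (N × (Fin s → MvPolynomial (Fin n) K)) ≃ₗ[MvPolynomial (Fin n) K]
      (Fin t → MvPolynomial (Fin n) K)) :
    ∃ t', Nonempty (N ≃ₗ[MvPolynomial (Fin n) K] (Fin t' → MvPolynomial (Fin n) K)) := by
  induction s generalizing t with
  | zero => exact ⟨t, ⟨(LinearEquiv.prodUnique).symm.trans ψ⟩⟩
  | succ s ih =>
    let A := MvPolynomial (Fin n) K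
    let e : (Fin (s + 1) → A) ≃ₗ[A] (Fin s → A) × A :=
      (Fin.consLinearEquiv A (fun _ ↦ A)).symm.trans (LinearEquiv.prodComm A _ _)
    obtain ⟨t', ⟨χ⟩⟩ := exists_linearEquiv_of_prod_self
      ((LinearEquiv.prodAssoc A N (Fin s → A) A).trans
        (((LinearEquiv.refl A N).prodCongr e.symm).trans ψ))
    exact ih χ

end Cancellation

universe u

/-- `HasStablyFreeResolution R d M`: the module `M` has a resolution of length `d` by finite free
modules, except that the last module is only required to be stably free. -/
def HasStablyFreeResolution (R : Type u) [CommRing R] :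
    ℕ → ∀ (M : Type u) [AddCommGroup M] [Module R M], Prop
  | 0, M, _, _ => ∃ s t : ℕ, Nonempty ((M × (Fin s → R)) ≃ₗ[R] (Fin t → R))
  | d + 1, M, _, _ => ∃ (k : ℕ) (f : (Fin k → R) →ₗ[R] M),
      Function.Surjective f ∧ HasStablyFreeResolution R d (LinearMap.ker f)

namespace HasStablyFreeResolution

section Transport

variable {R S : Type u} [CommRing R] [CommRing S] {σ : R →+* S} {σ' : S →+* R}
  [RingHomInvPair σ σ'] [RingHomInvPair σ' σ]

/-- A ring isomorphism, applied entrywise. -/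
def piSemilinearEquiv (σ : R →+* S) (σ' : S →+* R)
    [RingHomInvPair σ σ'] [RingHomInvPair σ' σ] (ι : Type*) : (ι → R) ≃ₛₗ[σ] (ι → S) where
  toFun v i := σ (v i)
  invFun v i := σ' (v i)
  map_add' _ _ := by ext; simp
  map_smul' _ _ := by ext; simp
  left_inv _ := by ext; simp
  right_inv _ := by ext; simp

theorem congr {d : ℕ} {M N : Type u} [AddCommGroup M] [Module R M] [AddCommGroup N] [Module S N]
    (e : M ≃ₛₗ[σ] N) (h : HasStablyFreeResolution R d M) : HasStablyFreeResolution S d N := by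
  induction d generalizing M N with
  | zero =>
    obtain ⟨s, t, ⟨ψ⟩⟩ := h
    let e₁ : (N × (Fin s → S)) ≃ₛₗ[σ'] (M × (Fin s → R)) :=
      { toFun := fun x ↦ (e.symm x.1, (piSemilinearEquiv σ σ' (Fin s)).symm x.2)
        invFun := fun x ↦ (e x.1, piSemilinearEquiv σ σ' (Fin s) x.2)
        map_add' := fun _ _ ↦ by simp
        map_smul' := fun _ _ ↦ Prod.ext (map_smulₛₗ _ _ _) (map_smulₛₗ _ _ _)
        left_inv := fun _ ↦ by simp
        right_inv := fun _ ↦ by simp }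
    exact ⟨s, t, ⟨(e₁.trans ψ).trans (piSemilinearEquiv σ σ' (Fin t))⟩⟩
  | succ d ih =>
    obtain ⟨k, f, hf, h⟩ := h
    let e₁ := (piSemilinearEquiv σ σ' (Fin k))
    let f' : (Fin k → S) →ₗ[S] N := e.toLinearMap ∘ₛₗ (f ∘ₛₗ e₁.symm.toLinearMap)
    have hker : (LinearMap.ker f).map e₁.toLinearMap = LinearMap.ker f' := by
      ext v
      simp [f']
    refine ⟨k, f', e.surjective.comp (hf.comp e₁.symm.surjective), ?_⟩
    exact ih ((e₁.submoduleMap (LinearMap.ker f)).trans (LinearEquiv.ofEq _ _ hker)) h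

end Transport

variable {R : Type u} [CommRing R] {A B C : Type u} [AddCommGroup A] [AddCommGroup B]
  [AddCommGroup C] [Module R A] [Module R B] [Module R C] {d : ℕ}

/-- The first module of a short exact sequence is the kernel of the second map. -/
theorem exists_linearEquiv_ker {i : A →ₗ[R] B} {p : B →ₗ[R] C} (hi : Function.Injective i)
    (hip : Function.Exact i p) : Nonempty (A ≃ₗ[R] LinearMap.ker p) :=
  ⟨(LinearEquiv.ofInjective i hi).trans
    (LinearEquiv.ofEq _ _ (LinearMap.exact_iff.1 hip).symm)⟩

theorem of_exact {k : ℕ} {i : A →ₗ[R] B} {p : B →ₗ[R] C} (e : B ≃ₗ[R] (Fin k → R))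
    (hi : Function.Injective i) (hip : Function.Exact i p) (hp : Function.Surjective p)
    (h : HasStablyFreeResolution R d A) : HasStablyFreeResolution R (d + 1) C := by
  obtain ⟨g⟩ := exists_linearEquiv_ker (i := e.toLinearMap ∘ₗ i) (p := p ∘ₗ e.symm.toLinearMap)
    (e.injective.comp hi) (fun x ↦ by
      simpa [LinearEquiv.eq_symm_apply] using hip (e.symm x))
  exact ⟨k, _, hp.comp e.symm.surjective, h.congr g⟩

theorem succ (h : HasStablyFreeResolution R d A) : HasStablyFreeResolution R (d + 1) A := by
  induction d generalizing A with
  | zero =>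
    obtain ⟨s, t, ⟨ψ⟩⟩ := h
    exact of_exact (d := 0) (i := LinearMap.inr R A (Fin s → R)) (p := LinearMap.fst R _ _) ψ
      LinearMap.inr_injective (fun x ↦ by
        obtain ⟨x, y⟩ := x
        simp [eq_comm]) LinearMap.fst_surjective
      ⟨0, s, ⟨LinearEquiv.prodUnique⟩⟩
  | succ d ih =>
    obtain ⟨k, f, hf, h⟩ := h
    exact ⟨k, f, hf, ih h⟩

theorem mono {d' : ℕ} (hd : d ≤ d') (h : HasStablyFreeResolution R d A) :
    HasStablyFreeResolution R d' A := by
  induction d', hd using Nat.le_induction with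
  | base => exact h
  | succ d' _ ih => exact ih.succ

variable (R) in
/-- Concatenation of vectors, as a linear equivalence. -/
noncomputable def prodPiEquiv (s t : ℕ) : ((Fin s → R) × (Fin t → R)) ≃ₗ[R] (Fin (s + t) → R) :=
  (LinearEquiv.sumArrowLequivProdArrow (Fin s) (Fin t) R R).symm.trans
    (LinearEquiv.funCongrLeft R R finSumFinEquiv.symm)

theorem extension {i : A →ₗ[R] B} {p : B →ₗ[R] C}
    (hi : Function.Injective i) (hip : Function.Exact i p) (hp : Function.Surjective p)
    (hA : HasStablyFreeResolution R d A) (hC : HasStablyFreeResolution R d C) :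
    HasStablyFreeResolution R d B := by
  induction d generalizing A B C with
  | zero =>
    obtain ⟨s, t, ⟨ψ⟩⟩ := hA
    obtain ⟨s', t', ⟨ψ'⟩⟩ := hC
    have : Module.Projective R C := .of_split (ψ'.toLinearMap ∘ₗ LinearMap.inl R C _)
      (LinearMap.fst R C _ ∘ₗ ψ'.symm.toLinearMap) (by ext; simp)
    obtain ⟨g, hg⟩ := p.exists_rightInverse_of_surjective (LinearMap.range_eq_top.2 hp)
    let e := (hip.splitSurjectiveEquiv hi ⟨g, hg⟩).1
    exact ⟨s + s', t + t', ⟨(e.prodCongr (prodPiEquiv R s s').symm).trans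
      ((LinearEquiv.prodProdProdComm R A C _ _).trans
        ((ψ.prodCongr ψ').trans (prodPiEquiv R t t')))⟩⟩
  | succ d ih =>
    obtain ⟨a, f, hf, hA⟩ := hA
    obtain ⟨c, g, hg, hC⟩ := hC
    obtain ⟨g', rfl⟩ := Module.projective_lifting_property p g hp
    let h : ((Fin a → R) × (Fin c → R)) →ₗ[R] B := (i ∘ₗ f).coprod g'
    let j : LinearMap.ker f →ₗ[R] LinearMap.ker h :=
      (LinearMap.inl R _ _).restrict fun x hx ↦ by
        simp [h, LinearMap.mem_ker.1 hx]
    let q : LinearMap.ker h →ₗ[R] LinearMap.ker (p ∘ₗ g') :=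
      (LinearMap.snd R _ _).restrict fun x hx ↦ by
        have := congrArg p (LinearMap.mem_ker.1 hx)
        simpa [h, hip.apply_apply_eq_zero] using this
    have hj : Function.Injective j := fun x y hxy ↦ Subtype.ext
      (congrArg (fun z ↦ z.1.1) hxy)
    have hjq : Function.Exact j q := by
      rintro ⟨⟨x, y⟩, hx⟩
      constructor
      · intro hy
        obtain rfl : y = 0 := congrArg Subtype.val hy
        refine ⟨⟨x, hi ?_⟩, rfl⟩
        simpa [h] using hx
      · rintro ⟨z, hz⟩
        exact Subtype.ext (congrArg (fun z ↦ z.1.2) hz).symm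
    have hq : Function.Surjective q := by
      rintro ⟨y, hy⟩
      obtain ⟨a, ha⟩ := (hip (g' y)).1 hy
      obtain ⟨x, rfl⟩ := hf a
      exact ⟨⟨(-x, y), by simp [h, ha]⟩, rfl⟩
    refine of_exact (i := (LinearMap.ker h).subtype) (p := h) (prodPiEquiv R a c)
      (Submodule.subtype_injective _) (LinearMap.exact_subtype_ker_map h) (fun b ↦ ?_)
      (ih hj hjq hq hA hC)
    obtain ⟨y, hy⟩ := hg (p b)
    obtain ⟨x, hx⟩ := (hip (b - g' y)).1 (by simpa [sub_eq_zero] using hy.symm)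
    obtain ⟨x, rfl⟩ := hf x
    exact ⟨(x, y), by simp [h, hx]⟩

theorem cokernel {i : A →ₗ[R] B} {p : B →ₗ[R] C}
    (hi : Function.Injective i) (hip : Function.Exact i p) (hp : Function.Surjective p)
    (hA : HasStablyFreeResolution R d A) (hB : HasStablyFreeResolution R d B) :
    HasStablyFreeResolution R (d + 1) C := by
  obtain ⟨k, g, hg, hB⟩ := hB.succ
  obtain ⟨e⟩ := exists_linearEquiv_ker hi hip
  let j : LinearMap.ker g →ₗ[R] LinearMap.ker (p ∘ₗ g) :=
    Submodule.inclusion (LinearMap.ker_le_ker_comp g p)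
  let q : LinearMap.ker (p ∘ₗ g) →ₗ[R] LinearMap.ker p := g.restrict fun x hx ↦ hx
  refine ⟨k, p ∘ₗ g, hp.comp hg, extension (i := j) (p := q) (Submodule.inclusion_injective _)
    ?_ ?_ hB (hA.congr e)⟩
  · rintro ⟨x, hx⟩
    constructor
    · intro h
      exact ⟨⟨x, congrArg Subtype.val h⟩, rfl⟩
    · rintro ⟨z, hz⟩
      refine Subtype.ext ?_
      have : z.1 = x := congrArg Subtype.val hz
      exact this ▸ z.2
  · rintro ⟨y, hy⟩
    obtain ⟨x, rfl⟩ := hg y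
    exact ⟨⟨x, hy⟩, rfl⟩

theorem zero_of_projective [Module.Projective R A] (h : HasStablyFreeResolution R d A) :
    HasStablyFreeResolution R 0 A := by
  induction d generalizing A with
  | zero => exact h
  | succ d ih =>
    obtain ⟨k, f, hf, h⟩ := h
    obtain ⟨g, hg⟩ := f.exists_rightInverse_of_surjective (LinearMap.range_eq_top.2 hf)
    let e := ((LinearMap.exact_subtype_ker_map f).splitSurjectiveEquiv
      (Submodule.subtype_injective _) ⟨g, hg⟩).1
    have : Module.Projective R (LinearMap.ker f) :=
      .of_split (e.symm.toLinearMap ∘ₗ LinearMap.inl R _ A)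
        (LinearMap.fst R _ A ∘ₗ e.toLinearMap) (by ext; simp)
    obtain ⟨s, t, ⟨ψ⟩⟩ := ih h
    exact ⟨t, k + s, ⟨((LinearEquiv.refl R A).prodCongr ψ.symm).trans
      ((LinearEquiv.prodAssoc R A _ _).symm.trans
      ((((LinearEquiv.prodComm R A _).trans e.symm).prodCongr (LinearEquiv.refl R _)).trans
        (prodPiEquiv R k s)))⟩⟩

open TensorProduct Polynomial in
theorem polynomial (h : HasStablyFreeResolution R d A) :
    HasStablyFreeResolution R[X] d (R[X] ⊗[R] A) := by
  induction d generalizing A with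
  | zero =>
    obtain ⟨s, t, ⟨ψ⟩⟩ := h
    exact ⟨s, t, ⟨((LinearEquiv.refl R[X] _).prodCongr
      (TensorProduct.piScalarRight R R[X] R[X] (Fin s)).symm).trans
      ((TensorProduct.prodRight R R[X] R[X] A _).symm.trans
        ((ψ.baseChange R R[X] _ _).trans (TensorProduct.piScalarRight R R[X] R[X] (Fin t))))⟩⟩
  | succ d ih =>
    obtain ⟨k, f, hf, h⟩ := h
    refine of_exact (i := (LinearMap.ker f).subtype.baseChange R[X]) (p := f.baseChange R[X])
      (TensorProduct.piScalarRight R R[X] R[X] (Fin k)) ?_ ?_ ?_ (ih h)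
    · exact Module.Flat.lTensor_preserves_injective_linearMap _ (Submodule.subtype_injective _)
    · exact lTensor_exact R[X] (LinearMap.exact_subtype_ker_map f) hf
    · exact LinearMap.lTensor_surjective R[X] hf

end HasStablyFreeResolution

section CharacteristicSequence

open TensorProduct Polynomial
open PolynomialModule (polynomialTensorProductLEquivPolynomialModule)

variable {R A B : Type*} [CommRing R] [AddCommGroup A] [Module R A] [AddCommGroup B] [Module R B]

/-- The map `m ⊗ Xʲ ↦ i m ⊗ Xʲ⁺¹ - x m ⊗ Xʲ`. -/
noncomputable def shiftSub (i x : A →ₗ[R] B) : R[X] ⊗[R] A →ₗ[R[X]] R[X] ⊗[R] B :=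
  (Polynomial.X : R[X]) • i.baseChange R[X] - x.baseChange R[X]

theorem shiftSub_one_tmul (i x : A →ₗ[R] B) (a : A) :
    shiftSub i x (1 ⊗ₜ a) = (Polynomial.X : R[X]) • (1 ⊗ₜ i a) - 1 ⊗ₜ x a := by
  simp [shiftSub]

theorem coeff_polynomialTensorProductLEquivPolynomialModule_tmul (p : R[X]) (a : A) (j : ℕ) :
    (polynomialTensorProductLEquivPolynomialModule R A (p ⊗ₜ a)).coeff j = p.coeff j • a := by
  have : polynomialTensorProductLEquivPolynomialModule R A (p ⊗ₜ a) =
      p • PolynomialModule.single R 0 a := rfl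
  rw [this, PolynomialModule.smul_single_apply]
  simp

theorem coeff_shiftSub (i x : A →ₗ[R] B) (z : R[X] ⊗[R] A) (j : ℕ) :
    (polynomialTensorProductLEquivPolynomialModule R B (shiftSub i x z)).coeff (j + 1) =
      i ((polynomialTensorProductLEquivPolynomialModule R A z).coeff j) -
        x ((polynomialTensorProductLEquivPolynomialModule R A z).coeff (j + 1)) := by
  induction z with
  | zero => simp
  | add z w hz hw => simp [hz, hw]; abel
  | tmul p a =>
    have : shiftSub i x (p ⊗ₜ a) = (Polynomial.X * p) ⊗ₜ[R] i a - p ⊗ₜ x a := by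
      simp [shiftSub, smul_tmul']
    have hsub (y y' : PolynomialModule R B) : (y - y').coeff (j + 1) =
        y.coeff (j + 1) - y'.coeff (j + 1) :=
      congrArg (fun f : ℕ →₀ B ↦ f (j + 1)) (map_sub PolynomialModule.coeffAddEquiv y y')
    rw [this, map_sub, hsub]
    simp [coeff_polynomialTensorProductLEquivPolynomialModule_tmul]

theorem shiftSub_injective {i : A →ₗ[R] B} (hi : Function.Injective i) (x : A →ₗ[R] B) :
    Function.Injective (shiftSub i x) := by
  rw [injective_iff_map_eq_zero]
  intro z hz
  set e := polynomialTensorProductLEquivPolynomialModule R A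
  obtain ⟨N, hN⟩ := (e z).coeff.support.exists_nat_subset_range
  have key (t j : ℕ) (h : N ≤ j + t) : (e z).coeff j = 0 := by
    induction t generalizing j with
    | zero =>
      by_contra hj
      have := hN (Finsupp.mem_support_iff.2 hj)
      rw [Finset.mem_range] at this
      omega
    | succ t ih =>
      have := coeff_shiftSub i x z j
      rw [hz, ih (j + 1) (by omega)] at this
      apply hi
      simpa using this.symm
  rw [← e.map_eq_zero_iff, ← PolynomialModule.coeff_eq_zero]
  ext j
  exact key N j (by omega)

/-- Vectors of polynomials of degree smaller than `n`. -/
noncomputable def degreeLTPi (R : Type*) [CommRing R] (k n : ℕ) : Submodule R (Fin k → R[X]) :=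
  Submodule.pi Set.univ fun _ ↦ degreeLT R n

theorem mem_degreeLTPi {k n : ℕ} {v : Fin k → R[X]} :
    v ∈ degreeLTPi R k n ↔ ∀ i, (v i).degree < n := by
  simp [degreeLTPi, mem_degreeLT]

theorem degreeLTPi_mono {k n n' : ℕ} (h : n ≤ n') : degreeLTPi R k n ≤ degreeLTPi R k n' := by
  intro v hv
  rw [mem_degreeLTPi] at *
  exact fun i ↦ (hv i).trans_le (by exact_mod_cast h)

theorem X_smul_mem_degreeLTPi {k n : ℕ} {v : Fin k → R[X]} (hv : v ∈ degreeLTPi R k n) :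
    (Polynomial.X : R[X]) • v ∈ degreeLTPi R k (n + 1) := by
  simp only [mem_degreeLTPi, Polynomial.degree_lt_iff_coeff_zero] at *
  intro i m hm
  obtain ⟨m, rfl⟩ : ∃ m', m = m' + 1 := ⟨m - 1, by omega⟩
  simpa using hv i m (by omega)

theorem exists_mem_degreeLTPi {k : ℕ} (s : Finset (Fin k → R[X])) :
    ∃ n, ∀ v ∈ s, v ∈ degreeLTPi R k n := by
  refine ⟨(s.sup fun v ↦ Finset.univ.sup fun i ↦ (v i).natDegree) + 1, fun v hv ↦ ?_⟩
  rw [mem_degreeLTPi]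
  intro i
  refine degree_le_natDegree.trans_lt ?_
  norm_cast
  refine Nat.lt_succ_of_le (le_trans ?_ (Finset.le_sup hv))
  exact Finset.le_sup (f := fun i ↦ (v i).natDegree) (Finset.mem_univ i)

theorem degreeLTPi_fg (R : Type*) [CommRing R] (k n : ℕ) : (degreeLTPi R k n).FG :=
  Submodule.fg_pi fun _ ↦ by
    classical
    rw [degreeLT_eq_span_X_pow]
    exact ⟨_, rfl⟩

theorem const_mem_degreeLTPi {k : ℕ} (n : ℕ) (c : Fin k → R) :
    (fun j ↦ Polynomial.C (c j)) ∈ degreeLTPi R k (n + 1) := by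
  rw [mem_degreeLTPi]
  exact fun j ↦ degree_C_le.trans_lt (by norm_cast; omega)

theorem single_mem_degreeLTPi {k : ℕ} (n : ℕ) (j : Fin k) :
    (Pi.single j 1 : Fin k → R[X]) ∈ degreeLTPi R k (n + 1) := by
  have h := const_mem_degreeLTPi (R := R) n (Pi.single j 1)
  have : (fun i ↦ Polynomial.C ((Pi.single j 1 : Fin k → R) i)) = Pi.single j 1 := by
    funext i
    rw [Pi.single_apply, Pi.single_apply]
    split_ifs <;> simp
  rwa [this] at h

/-- A map on vectors of polynomials of degree at most `n` commuting with multiplication by `X`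
extends to a linear map. -/
theorem exists_linearMap_eq_on_degreeLTPi {Q : Type*} [AddCommGroup Q] [Module R Q] [Module R[X] Q]
    [IsScalarTower R R[X] Q] {k n : ℕ} (β : degreeLTPi R k (n + 1) →ₗ[R] Q)
    (hβ : ∀ v (hv : v ∈ degreeLTPi R k n), (Polynomial.X : R[X]) •
      β ⟨v, degreeLTPi_mono n.le_succ hv⟩ =
        β ⟨(Polynomial.X : R[X]) • v, X_smul_mem_degreeLTPi hv⟩) :
    ∃ Θ : (Fin k → R[X]) →ₗ[R[X]] Q, ∀ v (hv : v ∈ degreeLTPi R k (n + 1)), Θ v = β ⟨v, hv⟩ := by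
  let Θ : (Fin k → R[X]) →ₗ[R[X]] Q := Fintype.linearCombination R[X]
    fun j ↦ β ⟨Pi.single j 1, single_mem_degreeLTPi n j⟩
  have hconst (c : Fin k → R) :
      Θ (fun j ↦ Polynomial.C (c j)) = β ⟨_, const_mem_degreeLTPi n c⟩ := by
    have : (⟨_, const_mem_degreeLTPi n c⟩ : degreeLTPi R k (n + 1)) =
        ∑ j, c j • ⟨Pi.single j 1, single_mem_degreeLTPi n j⟩ := by
      refine Subtype.ext (funext fun j ↦ ?_)
      simp [Pi.single_apply, Polynomial.smul_eq_C_mul]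
    rw [this, map_sum]
    simp only [Θ, Fintype.linearCombination_apply, map_smul]
    refine Finset.sum_congr rfl fun j _ ↦ ?_
    rw [← Polynomial.algebraMap_eq, algebraMap_smul]
  have key (n' : ℕ) (hn' : n' ≤ n + 1) (v) (hv : v ∈ degreeLTPi R k n') :
      Θ v = β ⟨v, degreeLTPi_mono hn' hv⟩ := by
    induction n' generalizing v with
    | zero =>
      obtain rfl : v = 0 := by
        simpa [mem_degreeLTPi, funext_iff] using hv
      rw [map_zero]
      exact (map_zero β).symm
    | succ n' ih =>
      have hw : (fun j ↦ (v j).divX) ∈ degreeLTPi R k n' := by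
        simp only [mem_degreeLTPi, Polynomial.degree_lt_iff_coeff_zero] at *
        intro j m hm
        simpa using hv j (m + 1) (by omega)
      have hvw : v = (Polynomial.X : R[X]) • (fun j ↦ (v j).divX) +
          fun j ↦ Polynomial.C ((v j).coeff 0) :=
        funext fun j ↦ (X_mul_divX_add (v j)).symm
      have h1 := ih (by omega) _ hw
      conv_lhs => rw [hvw]
      rw [map_add, map_smul, h1, hconst, hβ _ (degreeLTPi_mono (Nat.le_of_succ_le_succ hn') hw),
        ← map_add]
      exact congrArg β (Subtype.ext hvw.symm)
  exact ⟨Θ, key (n + 1) le_rfl⟩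

theorem HasStablyFreeResolution.exists_of_isScalarTower {R : Type u} [CommRing R]
    [IsNoetherianRing R]
    (hR : ∀ (M : Type u) [AddCommGroup M] [Module R M] [Module.Finite R M],
      ∃ d, HasStablyFreeResolution R d M)
    (M : Type u) [AddCommGroup M] [Module R M] [Module R[X] M] [IsScalarTower R R[X] M]
    [Module.Finite R[X] M] : ∃ d, HasStablyFreeResolution R[X] d M := by
  obtain ⟨k, φ, hφ⟩ := Module.Finite.exists_fin' R[X] M
  obtain ⟨s, hs⟩ := IsNoetherian.noetherian (LinearMap.ker φ)
  obtain ⟨n, hn⟩ := exists_mem_degreeLTPi s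
  replace hn (v) (hv : v ∈ s) : v ∈ degreeLTPi R k (n + 1) :=
    degreeLTPi_mono n.le_succ (hn v hv)
  let N (n : ℕ) : Submodule R M := (degreeLTPi R k n).map (φ.restrictScalars R)
  have hN (n : ℕ) : Module.Finite R (N n) :=
    Module.Finite.iff_fg.2 ((degreeLTPi_fg R k n).map _)
  let i : N n →ₗ[R] N (n + 1) :=
    Submodule.inclusion (Submodule.map_mono (degreeLTPi_mono n.le_succ))
  let x : N n →ₗ[R] N (n + 1) :=
    (Algebra.lsmul R R M (Polynomial.X : R[X])).restrict <| by
      rintro _ ⟨v, hv, rfl⟩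
      exact ⟨_, X_smul_mem_degreeLTPi hv, map_smul φ _ _⟩
  let b : degreeLTPi R k (n + 1) →ₗ[R] N (n + 1) :=
    (φ.restrictScalars R).restrict fun v hv ↦ ⟨v, hv, rfl⟩
  have hb : Function.Surjective b := by
    rintro ⟨_, v, hv, rfl⟩
    exact ⟨⟨v, hv⟩, rfl⟩
  let ε : R[X] ⊗[R] N (n + 1) →ₗ[R[X]] M := (N (n + 1)).subtype.liftBaseChange R[X]
  have hε (p : R[X]) (m : N (n + 1)) : ε (p ⊗ₜ m) = p • (m : M) := rfl
  have hcomp : ε ∘ₗ shiftSub i x = 0 := by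
    refine TensorProduct.AlgebraTensorModule.ext fun p m ↦ ?_
    have h : p ⊗ₜ[R] m = p • (1 ⊗ₜ[R] m) := by rw [smul_tmul', smul_eq_mul, mul_one]
    have hx : ((x m : N (n + 1)) : M) = (Polynomial.X : R[X]) • (m : M) := rfl
    have hi : ((i m : N (n + 1)) : M) = m := Submodule.coe_inclusion _ _
    rw [h, map_smul, LinearMap.comp_apply, shiftSub_one_tmul, map_sub, map_smul, hε, hε, one_smul,
      one_smul, hx, hi, sub_self, smul_zero, LinearMap.zero_apply]
  let π := (LinearMap.range (shiftSub i x)).mkQ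
  have hπ (m : N n) : (Polynomial.X : R[X]) • π (1 ⊗ₜ i m) = π (1 ⊗ₜ x m) := by
    rw [← map_smul, ← sub_eq_zero, ← map_sub, ← shiftSub_one_tmul]
    exact (Submodule.Quotient.mk_eq_zero _).2 ⟨_, rfl⟩
  obtain ⟨Θ, hΘ⟩ := exists_linearMap_eq_on_degreeLTPi
    (π.restrictScalars R ∘ₗ TensorProduct.mk R R[X] (N (n + 1)) 1 ∘ₗ b) fun v hv ↦ by
      refine (hπ ⟨φ v, v, hv, rfl⟩).trans ?_
      refine congrArg (fun z ↦ π (1 ⊗ₜ z)) (Subtype.ext ?_)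
      exact (map_smul φ _ _).symm
  replace hΘ (v) (hv : v ∈ degreeLTPi R k (n + 1)) : Θ v = π (1 ⊗ₜ b ⟨v, hv⟩) := hΘ v hv
  let ε' := Submodule.liftQ _ ε (LinearMap.range_le_ker_iff.2 hcomp)
  have hε' (z) : ε' (π z) = ε z := rfl
  have hΘφ : ε' ∘ₗ Θ = φ := by
    refine LinearMap.pi_ext' fun j ↦ LinearMap.ext_ring ?_
    simp only [LinearMap.comp_apply, LinearMap.single_apply]
    rw [hΘ _ (single_mem_degreeLTPi n j), hε', hε, one_smul]
    rfl
  have hΘsurj : Function.Surjective Θ := by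
    rw [← LinearMap.range_eq_top, eq_top_iff]
    intro z _
    obtain ⟨z, rfl⟩ := Submodule.mkQ_surjective _ z
    induction z with
    | zero => exact Submodule.zero_mem _
    | add z w hz hw =>
      rw [map_add]
      exact Submodule.add_mem _ (hz trivial) (hw trivial)
    | tmul p m =>
      obtain ⟨⟨v, hv⟩, rfl⟩ := hb m
      refine ⟨p • v, ?_⟩
      rw [map_smul, hΘ v hv, ← map_smul, smul_tmul', smul_eq_mul, mul_one]
  have hker : LinearMap.ker φ ≤ LinearMap.ker Θ := by
    rw [← hs, Submodule.span_le]
    intro v hv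
    have hv0 : φ v = 0 := LinearMap.mem_ker.1 (hs ▸ Submodule.subset_span hv)
    have h0 : b ⟨v, hn v hv⟩ = 0 := Subtype.ext hv0
    change Θ v = 0
    rw [hΘ v (hn v hv), h0, tmul_zero, map_zero]
  obtain ⟨d₁, hd₁⟩ := hR (N n)
  obtain ⟨d₂, hd₂⟩ := hR (N (n + 1))
  refine ⟨max d₁ d₂ + 1, cokernel (i := shiftSub i x) (p := ε)
    (shiftSub_injective (Submodule.inclusion_injective _) x) ?_ ?_
    (hd₁.mono (le_max_left _ _)).polynomial (hd₂.mono (le_max_right _ _)).polynomial⟩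
  · intro z
    constructor
    · intro hz
      obtain ⟨v, hv⟩ := hΘsurj (π z)
      have : φ v = 0 := by
        rw [← hΘφ, LinearMap.comp_apply, hv, hε', hz]
      rw [hker this] at hv
      exact (Submodule.Quotient.mk_eq_zero _).1 hv.symm
    · rintro ⟨w, rfl⟩
      exact LinearMap.congr_fun hcomp w
  · intro m
    obtain ⟨v, rfl⟩ := hφ m
    obtain ⟨z, hz⟩ := Submodule.mkQ_surjective _ (Θ v)
    exact ⟨z, by rw [← hΘφ, LinearMap.comp_apply, ← hz]; rfl⟩

theorem HasStablyFreeResolution.exists_polynomial {R : Type u} [CommRing R] [IsNoetherianRing R]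
    (hR : ∀ (M : Type u) [AddCommGroup M] [Module R M] [Module.Finite R M],
      ∃ d, HasStablyFreeResolution R d M)
    (M : Type u) [AddCommGroup M] [Module R[X] M] [Module.Finite R[X] M] :
    ∃ d, HasStablyFreeResolution R[X] d M := by
  let : Module R M := Module.compHom M (Polynomial.C : R →+* R[X])
  have : IsScalarTower R R[X] M := ⟨fun a p m ↦ by
    rw [Polynomial.smul_eq_C_mul, mul_smul]; rfl⟩
  exact exists_of_isScalarTower hR M

end CharacteristicSequence

section Freeness

theorem HasStablyFreeResolution.exists_of_ringEquiv {R S : Type u} [CommRing R] [CommRing S]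
    (e : R ≃+* S)
    (hR : ∀ (M : Type u) [AddCommGroup M] [Module R M] [Module.Finite R M],
      ∃ d, HasStablyFreeResolution R d M)
    (M : Type u) [AddCommGroup M] [Module S M] [Module.Finite S M] :
    ∃ d, HasStablyFreeResolution S d M := by
  let : Module R M := Module.compHom M (e : R →+* S)
  have h₁ : RingHomInvPair (e : R →+* S) (e.symm : S →+* R) := RingHomInvPair.of_ringEquiv e
  have h₂ : RingHomInvPair (e.symm : S →+* R) (e : R →+* S) := RingHomInvPair.of_ringEquiv e.symm
  let g : M ≃ₛₗ[(e : R →+* S)] M :=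
    { AddEquiv.refl M with map_smul' := fun _ _ ↦ rfl }
  have : Module.Finite R M :=
    Module.Finite.of_surjective g.symm.toLinearMap g.symm.surjective
  obtain ⟨d, hd⟩ := hR M
  exact ⟨d, hd.congr g⟩

theorem HasStablyFreeResolution.exists_mvPolynomial {K : Type u} [Field K] (n : ℕ)
    (M : Type u) [AddCommGroup M] [Module (MvPolynomial (Fin n) K) M]
    [Module.Finite (MvPolynomial (Fin n) K) M] :
    ∃ d, HasStablyFreeResolution (MvPolynomial (Fin n) K) d M := by
  induction n generalizing M with
  | zero =>
    exact exists_of_ringEquiv (isEmptyAlgEquiv K (Fin 0)).symm.toRingEquiv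
      (fun M _ _ _ ↦ ⟨0, 0, Module.finrank K M,
        ⟨LinearEquiv.prodUnique.trans (Module.finBasis K M).equivFun⟩⟩) M
  | succ n ih =>
    exact exists_of_ringEquiv (finSuccEquiv K n).symm.toRingEquiv
      (fun M _ _ _ ↦ exists_polynomial ih M) M

/-- The Quillen–Suslin theorem. -/
theorem exists_linearEquiv_of_projective {K : Type u} [Field K] {n : ℕ} (M : Type u)
    [AddCommGroup M] [Module (MvPolynomial (Fin n) K) M]
    [Module.Finite (MvPolynomial (Fin n) K) M] [Module.Projective (MvPolynomial (Fin n) K) M] :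
    ∃ t, Nonempty (M ≃ₗ[MvPolynomial (Fin n) K] (Fin t → MvPolynomial (Fin n) K)) := by
  obtain ⟨d, hd⟩ := HasStablyFreeResolution.exists_mvPolynomial (K := K) n M
  obtain ⟨s, t, ⟨ψ⟩⟩ := hd.zero_of_projective
  exact exists_linearEquiv_of_prod_pi ψ

end Freeness

section ConstantRank

theorem dvd_det_submatrix {R : Type*} [CommRing R] {l m k : ℕ} {F : Matrix (Fin l) (Fin m) R}
    {d : R} (hd : ∀ a ∈ minorsSet k F, d ∣ a) (ri : Fin k → Fin l) (ci : Fin k → Fin m) :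
    d ∣ (F.submatrix ri ci).det := by
  by_cases hr : Function.Injective ri
  · by_cases hc : Function.Injective ci
    · exact hd _ ⟨ri, ci, hr, hc, rfl⟩
    · obtain ⟨i, j, h, hij⟩ := Function.not_injective_iff.1 hc
      rw [det_zero_of_column_eq hij fun a ↦ by simp [h]]
      exact dvd_zero d
  · obtain ⟨i, j, h, hij⟩ := Function.not_injective_iff.1 hr
    rw [det_zero_of_row_eq hij (by ext; simp [h])]
    exact dvd_zero d

theorem mul_eq_zero_of_vecMul_eq_zero {R : Type*} [CommRing R] {l m : ℕ}
    {F : Matrix (Fin l) (Fin m) R} {Q A : Matrix (Fin l) (Fin l) R}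
    (hQ : ∀ v, v ᵥ* F = 0 → v ᵥ* Q = 0) (hA : A * F = 0) : A * Q = 0 := by
  refine funext fun i ↦ ?_
  exact hQ (A i) (congrFun hA i)

/-- Expansion of a bordered determinant. -/
theorem det_fromBlocks_replicate {R ι : Type*} [CommRing R] [IsDomain R] [Fintype ι]
    [DecidableEq ι] (B : Matrix ι ι R) (hB : B.det ≠ 0) (u y : ι → R) (w : R) :
    (fromBlocks B (replicateCol (Fin 1) u) (replicateRow (Fin 1) y) (of fun _ _ ↦ w)).det =
      B.det * w - y ⬝ᵥ (B.adjugate *ᵥ u) := by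
  apply mul_right_cancel₀ hB
  have h : fromBlocks B (replicateCol (Fin 1) u) (replicateRow (Fin 1) y) (of fun _ _ ↦ w) *
      fromBlocks 1 (replicateCol (Fin 1) (-(B.adjugate *ᵥ u))) 0 (of fun _ _ ↦ B.det) =
      fromBlocks B 0 (replicateRow (Fin 1) y)
        (of fun _ _ ↦ B.det * w - y ⬝ᵥ (B.adjugate *ᵥ u)) := by
    rw [fromBlocks_multiply]
    congr 1
    · simp
    · ext a b
      have : B *ᵥ (B.adjugate *ᵥ u) = B.det • u := by
        rw [mulVec_mulVec, mul_adjugate, smul_mulVec, one_mulVec]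
      have := congrFun this a
      simp [mul_apply, mulVec, dotProduct] at this ⊢
      rw [this]
      ring
    · simp
    · ext a b
      simp [mul_apply, dotProduct]
      ring
  have := congrArg det h
  rw [det_mul, det_fromBlocks_zero₂₁, det_fromBlocks_zero₁₂] at this
  simpa [mul_comm] using this

variable {S : Type*} [CommRing S] [IsDomain S] {l m k : ℕ} {F : Matrix (Fin l) (Fin m) S}

theorem det_smul_eq_mul_adjugate_mul (hF : ∀ a ∈ minorsSet (k + 1) F, a = 0)
    (ri : Fin k → Fin l) (ci : Fin k → Fin m) (hB : (F.submatrix ri ci).det ≠ 0) :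
    (F.submatrix ri ci).det • F =
      F.submatrix id ci * (F.submatrix ri ci).adjugate * F.submatrix ri id := by
  ext a c
  have h := dvd_det_submatrix (d := (0 : S)) (fun a ha ↦ zero_dvd_iff.2 (hF a ha))
    (Sum.elim ri (fun _ : Fin 1 ↦ a) ∘ finSumFinEquiv.symm)
    (Sum.elim ci (fun _ : Fin 1 ↦ c) ∘ finSumFinEquiv.symm)
  rw [zero_dvd_iff, ← submatrix_submatrix, det_submatrix_equiv_self] at h
  have h' : F.submatrix (Sum.elim ri (fun _ : Fin 1 ↦ a)) (Sum.elim ci (fun _ : Fin 1 ↦ c)) =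
      fromBlocks (F.submatrix ri ci) (replicateCol (Fin 1) fun i ↦ F (ri i) c)
        (replicateRow (Fin 1) fun j ↦ F a (ci j)) (of fun _ _ ↦ F a c) := by
    ext (i | i) (j | j) <;> rfl
  rw [h', det_fromBlocks_replicate _ hB, sub_eq_zero] at h
  rw [Matrix.smul_apply, smul_eq_mul, h, Matrix.mul_assoc]
  rfl

theorem exists_smul_eq_mul_mul {δ β : S} (hδ : δ ≠ 0) (hdvd : ∀ a ∈ minorsSet k F, δ ∣ a)
    (hF : ∀ a ∈ minorsSet (k + 1) F, a = 0) (hβ : δ * β ∈ minorsSet k F) :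
    ∃ (T : Matrix (Fin l) (Fin k) S) (U : Matrix (Fin k) (Fin l) S),
      β • F = T * U * F ∧ ∀ v, v ᵥ* F = 0 → v ᵥ* T = 0 := by
  obtain rfl | hβ0 := eq_or_ne β 0
  · exact ⟨0, 0, by simp, by simp⟩
  obtain ⟨ri, ci, -, -, hB⟩ := hβ
  have hT (a : Fin l) (j : Fin k) :
      δ ∣ (F.submatrix id ci * (F.submatrix ri ci).adjugate) a j := by
    have : (F.submatrix id ci * (F.submatrix ri ci).adjugate) a j =
        (F.submatrix (Function.update ri j a) ci).det := by
      have h : F.submatrix (Function.update ri j a) ci =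
          (F.submatrix ri ci).updateRow j fun s ↦ F a (ci s) := by
        ext i s
        obtain rfl | hij := eq_or_ne i j <;> simp [*]
      rw [h, det_eq_sum_mul_adjugate_row _ j, mul_apply]
      simp [adjugate_apply]
    rw [this]
    exact dvd_det_submatrix hdvd _ _
  choose T hT using hT
  have hT' : F.submatrix id ci * (F.submatrix ri ci).adjugate = δ • of T := by
    ext a j
    exact hT a j
  have h := det_smul_eq_mul_adjugate_mul hF ri ci (hB ▸ mul_ne_zero hδ hβ0)
  refine ⟨of T, (1 : Matrix (Fin l) (Fin l) S).submatrix ri id, ?_, fun v hv ↦ ?_⟩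
  · apply smul_right_injective _ hδ
    change δ • β • F = δ • _
    rw [smul_smul, hB, h, hT', Matrix.mul_assoc, smul_mul]
    congr 2
    ext i j
    simp [mul_apply, one_apply]
  · apply smul_right_injective _ hδ
    change δ • _ = δ • _
    rw [← vecMul_smul, ← hT', ← vecMul_vecMul]
    have : v ᵥ* F.submatrix id ci = 0 := by
      ext j
      exact congrFun hv (ci j)
    rw [this, zero_vecMul, smul_zero]

theorem exists_mul_eq_self {δ : S} (hδ : δ ≠ 0) (hdvd : ∀ a ∈ minorsSet k F, δ ∣ a)
    (hF : ∀ a ∈ minorsSet (k + 1) F, a = 0)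
    (hspan : Ideal.span {b | δ * b ∈ minorsSet k F} = ⊤) :
    ∃ Q : Matrix (Fin l) (Fin l) S, Q * F = F ∧ ∀ v, v ᵥ* F = 0 → v ᵥ* Q = 0 := by
  let I : Ideal S :=
    { carrier := {b | ∃ Q : Matrix (Fin l) (Fin l) S, Q * F = b • F ∧
        ∀ v, v ᵥ* F = 0 → v ᵥ* Q = 0}
      add_mem' := by
        rintro b c ⟨Q, hQ, hQ'⟩ ⟨Q₁, hQ₁, hQ₁'⟩
        exact ⟨Q + Q₁, by rw [Matrix.add_mul, hQ, hQ₁, add_smul], fun v hv ↦ by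
          rw [vecMul_add, hQ' v hv, hQ₁' v hv, add_zero]⟩
      zero_mem' := ⟨0, by simp, by simp⟩
      smul_mem' := by
        rintro c b ⟨Q, hQ, hQ'⟩
        exact ⟨c • Q, by rw [smul_mul, hQ, smul_smul, smul_eq_mul], fun v hv ↦ by
          rw [vecMul_smul, hQ' v hv, smul_zero]⟩ }
  have hI : Ideal.span {b | δ * b ∈ minorsSet k F} ≤ I := by
    refine Ideal.span_le.2 fun b hb ↦ ?_
    obtain ⟨T, U, h, h'⟩ := exists_smul_eq_mul_mul hδ hdvd hF hb
    exact ⟨T * U, h.symm, fun v hv ↦ by rw [← vecMul_vecMul, h' v hv, zero_vecMul]⟩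
  obtain ⟨Q, hQ, hQ'⟩ : (1 : S) ∈ I := hI (hspan ▸ Submodule.mem_top)
  exact ⟨Q, by rw [hQ, one_smul], hQ'⟩

theorem exists_isUnit_det_mul_eq_zero {n : ℕ} {K : Type*} [Field K]
    {F : Matrix (Fin l) (Fin m) (MvPolynomial (Fin n) K)}
    {δ : MvPolynomial (Fin n) K} (hδ : δ ≠ 0) (hdvd : ∀ a ∈ minorsSet k F, δ ∣ a)
    (hF : ∀ a ∈ minorsSet (k + 1) F, a = 0)
    (hspan : Ideal.span {b | δ * b ∈ minorsSet k F} = ⊤) :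
    ∃ W : Matrix (Fin l) (Fin l) (MvPolynomial (Fin n) K), IsUnit W.det ∧
      ∀ a : Fin l, k ≤ a → (W * F) a = 0 := by
  let S := MvPolynomial (Fin n) K
  obtain ⟨Q, hQF, hQ⟩ := exists_mul_eq_self hδ hdvd hF hspan
  have hQQ : Q * Q = Q := by
    have := mul_eq_zero_of_vecMul_eq_zero hQ (A := 1 - Q) (by
      rw [Matrix.sub_mul, Matrix.one_mul, hQF, sub_self])
    rwa [Matrix.sub_mul, Matrix.one_mul, sub_eq_zero, eq_comm] at this
  let f : (Fin l → S) →ₗ[S] (Fin l → S) := Q.vecMulLinear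
  have hf (v) : f v = v ᵥ* Q := rfl
  have hff (v) : f (f v) = f v := by rw [hf, hf, vecMul_vecMul, hQQ]
  have hfr (w) (hw : w ∈ LinearMap.range f) : f w = w := by
    obtain ⟨v, rfl⟩ := hw
    exact hff v
  have hidem : IsIdempotentElem f := LinearMap.ext hff
  have : Module.Projective S (LinearMap.range f) :=
    .of_split (LinearMap.range f).subtype f.rangeRestrict
      (LinearMap.ext fun w ↦ Subtype.ext (hfr w w.2))
  have : Module.Projective S (LinearMap.ker f) :=
    .of_split (LinearMap.ker f).subtype
      ((LinearMap.id - f).codRestrict _ fun v ↦ by simp [hff])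
      (LinearMap.ext fun w ↦ Subtype.ext (by simp))
  obtain ⟨k', ⟨φ⟩⟩ := exists_linearEquiv_of_projective (K := K) (n := n) (LinearMap.range f)
  obtain ⟨t, ⟨ψ⟩⟩ := exists_linearEquiv_of_projective (K := K) (n := n) (LinearMap.ker f)
  have hk : k' ≤ k := by
    obtain ⟨β, hβ, hβ0⟩ : ∃ β, δ * β ∈ minorsSet k F ∧ β ≠ 0 := by
      by_contra! h
      have : Ideal.span {b | δ * b ∈ minorsSet k F} ≤ ⊥ :=
        Ideal.span_le.2 fun b hb ↦ h b hb
      exact bot_ne_top (eq_top_iff.2 (hspan ▸ this))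
    obtain ⟨T, U, h, -⟩ := exists_smul_eq_mul_mul hδ hdvd hF hβ
    have h1 : β • Q = T * U * Q := by
      have := mul_eq_zero_of_vecMul_eq_zero hQ (A := β • 1 - T * U) (by
        rw [Matrix.sub_mul, smul_mul, Matrix.one_mul, h, sub_self])
      rwa [Matrix.sub_mul, smul_mul, Matrix.one_mul, sub_eq_zero] at this
    refine le_of_fin_injective S
      (T.vecMulLinear ∘ₗ (LinearMap.range f).subtype ∘ₗ φ.symm.toLinearMap) ?_
    have hinj : Function.Injective (T.vecMulLinear ∘ₗ (LinearMap.range f).subtype) := by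
      rw [injective_iff_map_eq_zero]
      rintro ⟨w, hw⟩ hwT
      replace hwT : w ᵥ* T = 0 := hwT
      have : β • w = 0 := by
        conv_lhs => rw [← hfr w hw, hf, ← vecMul_smul, h1, ← vecMul_vecMul, ← vecMul_vecMul, hwT]
        simp
      exact Subtype.ext ((smul_eq_zero.1 this).resolve_left hβ0)
    exact hinj.comp φ.symm.injective
  let Φ := (((HasStablyFreeResolution.prodPiEquiv S k' t).symm.trans
    (φ.symm.prodCongr ψ.symm)).trans
      (Submodule.prodEquivOfIsCompl _ _ (LinearMap.IsIdempotentElem.isCompl hidem)))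
  obtain rfl : k' + t = l := eq_of_fin_equiv S Φ
  refine ⟨(LinearMap.toMatrix' Φ.toLinearMap)ᵀ, ?_, fun a ha ↦ ?_⟩
  · rw [det_transpose, LinearMap.det_toMatrix']
    exact Φ.isUnit_det'
  · have hrow : (LinearMap.toMatrix' Φ.toLinearMap)ᵀ a ∈ LinearMap.ker f := by
      have ha' : ((HasStablyFreeResolution.prodPiEquiv S k' t).symm (Pi.single a 1)).1 = 0 := by
        refine funext fun j ↦ Pi.single_eq_of_ne (fun h ↦ ?_) _
        have := congrArg Fin.val h
        simp at this
        omega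
      have : (LinearMap.toMatrix' Φ.toLinearMap)ᵀ a = Φ (Pi.single a 1) := by
        refine funext fun j ↦ ?_
        rw [transpose_apply, LinearMap.toMatrix'_apply]
        rfl
      rw [this]
      simp [Φ, ha']
    have : (LinearMap.toMatrix' Φ.toLinearMap)ᵀ a ᵥ* (Q * F) = 0 := by
      rw [← vecMul_vecMul, ← hf, LinearMap.mem_ker.1 hrow, zero_vecMul]
    rwa [hQF] at this

theorem exists_isUnit_det_X_dvd_mul {K : Type*} [Field K] {n : ℕ} (i : Fin n)
    {F : Matrix (Fin l) (Fin m) (MvPolynomial (Fin n) K)} {d : MvPolynomial (Fin n) K}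
    (hd : ¬ X i ∣ d) (hdvd : ∀ a ∈ minorsSet k F, d ∣ a)
    (hX : ∀ a ∈ minorsSet (k + 1) F, X i ∣ a)
    (hspan : Ideal.span {b | d * b ∈ minorsSet k F} = ⊤) :
    ∃ W : Matrix (Fin l) (Fin l) (MvPolynomial (Fin n) K), IsUnit W.det ∧
      (∀ a b, W a b ∈ supported K ({i}ᶜ : Set (Fin n))) ∧
      ∀ (a : Fin l) b, k ≤ a → X i ∣ (W * F) a b := by
  obtain _ | n := n
  · exact i.elim0
  let ι : MvPolynomial (Fin n) K →ₐ[K] MvPolynomial (Fin (n + 1)) K := rename i.succAbove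
  let π : MvPolynomial (Fin (n + 1)) K →ₐ[K] MvPolynomial (Fin n) K :=
    aeval (i.insertNth 0 X)
  have hπX : π (X i) = 0 := by simp [π]
  have hπι (f) : π (ι f) = f := by
    have : π.comp ι = AlgHom.id K _ := by
      ext j
      simp [π, ι]
    exact AlgHom.congr_fun this f
  have hιπ (f) : X i ∣ f - ι (π f) := by
    induction f using MvPolynomial.induction_on with
    | C a => simp [π, ι]
    | add f g hf hg =>
      rw [map_add, map_add, add_sub_add_comm]
      exact dvd_add hf hg
    | mul_X f j hf =>
      have hj : X i ∣ X j - ι (π (X j)) := by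
        cases j using i.succAboveCases with
        | x => simp [hπX]
        | p j => simp [π, ι]
      have : f * X j - ι (π (f * X j)) =
          (f - ι (π f)) * X j + ι (π f) * (X j - ι (π (X j))) := by
        rw [map_mul, map_mul]
        ring
      rw [this]
      exact dvd_add (hf.mul_right _) (hj.mul_left _)
  have hπ0 {f} : π f = 0 ↔ X i ∣ f := by
    constructor
    · intro h
      simpa [h] using hιπ f
    · rintro ⟨g, rfl⟩
      rw [map_mul, hπX, zero_mul]
  have hminor {k} : minorsSet k (F.map π) = π '' minorsSet k F := by
    ext a
    constructor
    · rintro ⟨ri, ci, hri, hci, rfl⟩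
      exact ⟨_, ⟨ri, ci, hri, hci, rfl⟩, AlgHom.map_det π _⟩
    · rintro ⟨_, ⟨ri, ci, hri, hci, rfl⟩, rfl⟩
      exact ⟨ri, ci, hri, hci, AlgHom.map_det π _⟩
  obtain ⟨W, hW, hWF⟩ := exists_isUnit_det_mul_eq_zero (F := F.map π) (k := k) (δ := π d)
    (fun h ↦ hd (hπ0.1 h))
    (by
      rw [hminor]
      rintro _ ⟨a, ha, rfl⟩
      exact map_dvd π (hdvd a ha))
    (by
      rw [hminor]
      rintro _ ⟨a, ha, rfl⟩
      exact hπ0.2 (hX a ha))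
    (by
      rw [eq_top_iff, ← Ideal.map_top π, ← hspan, Ideal.map_span]
      refine Ideal.span_mono ?_
      rintro _ ⟨b, hb, rfl⟩
      rw [Set.mem_ofPred_eq, hminor]
      exact ⟨_, hb, map_mul π d b⟩)
  refine ⟨W.map ι, ?_, fun a b ↦ ?_, fun a b ha ↦ ?_⟩
  · have : (W.map ι).det = ι W.det := (AlgHom.map_det ι W).symm
    rw [this]
    exact hW.map ι
  · rw [mem_supported, map_apply]
    intro j hj
    obtain ⟨j', -, rfl⟩ := Finset.mem_image.1 (vars_rename _ _ hj)
    exact i.succAbove_ne j'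
  · rw [← hπ0]
    have := congrFun (hWF a ha) b
    rw [mul_apply] at this ⊢
    simpa [hπι] using this

theorem exists_eq_diagonal_mul {R : Type*} [CommRing R] {A : Matrix (Fin l) (Fin m) R}
    {d : Fin l → R} (h : ∀ a b, d a ∣ A a b) :
    ∃ B : Matrix (Fin l) (Fin m) R, A = diagonal d * B := by
  choose B hB using h
  exact ⟨of B, Matrix.ext fun a b ↦ by rw [diagonal_mul, of_apply, hB]⟩

end ConstantRank

/-- For `F` of full row rank with `d_l(F)` associated to `x₁^p x₂^q` and
`i ∈ {1,2}`: if `xᵢ ∤ d_{l-r}(F)`, `J_{l-r}(F) = R` and `xᵢ ∣ d_{l-r+1}(F)`, then there is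
a unimodular `W` with entries not involving `xᵢ` and `F₁` such that
`W * F = diag(1,…,1,xᵢ,…,xᵢ) * F₁` (with `l-r` ones and `r` copies of `xᵢ`). -/
theorem statement4 {K : Type*} [Field K] {n l m : ℕ} (hlm : l ≤ m)
    (v1 v2 : Fin n) (hv1 : (v1 : ℕ) = 0) (hv2 : (v2 : ℕ) = 1)
    (r : ℕ) (hr : r ≤ l)
    (F : Matrix (Fin l) (Fin m) (MvPolynomial (Fin n) K))
    (hfull : normalRank F = l)
    (p q : ℕ) (hp : 0 < p) (hq : 0 < q)
    (dl : MvPolynomial (Fin n) K) (hdl : IsGcdMinors l F dl)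
    (hdlv : Associated dl (X v1 ^ p * X v2 ^ q))
    (i : Fin n) (hi : i = v1 ∨ i = v2)
    (dlr : MvPolynomial (Fin n) K) (hdlr : IsGcdMinors (l - r) F dlr)
    (hnd : ¬ X i ∣ dlr)
    (hJ : JEqTop (l - r) F)
    (dlr1 : MvPolynomial (Fin n) K) (hdlr1 : IsGcdMinors (l - r + 1) F dlr1)
    (hdvd : X i ∣ dlr1) :
    ∃ (W : Matrix (Fin l) (Fin l) (MvPolynomial (Fin n) K))
      (F1 : Matrix (Fin l) (Fin m) (MvPolynomial (Fin n) K)),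
      IsUnit W.det ∧
      (∀ a b, W a b ∈ MvPolynomial.supported K (({i} : Set (Fin n))ᶜ)) ∧
      W * F =
        Matrix.diagonal (fun j : Fin l => if (j : ℕ) < l - r then 1 else X i) * F1 := by
  obtain ⟨d, ⟨hd, hd'⟩, hspan⟩ := hJ
  obtain ⟨W, hW, hWs, hWF⟩ := exists_isUnit_det_X_dvd_mul i
    (fun h ↦ hnd (h.trans (hdlr.2 d hd))) hd (fun a ha ↦ hdvd.trans (hdlr1.1 a ha)) hspan
  have h (a : Fin l) (b : Fin m) : (if (a : ℕ) < l - r then 1 else X i) ∣ (W * F) a b := by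
    split_ifs with ha
    · exact one_dvd _
    · exact hWF a b (not_lt.1 ha)
  obtain ⟨F1, hF1⟩ := exists_eq_diagonal_mul h
  exact ⟨W, F1, hW, hWs, hF1⟩
end
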